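/- arXiv:1907.09338 — 10 statements merged into one kernel-verified Lean document; each statement's English description precedes it below -/
import Mathlib

section
/- Let λ be an infinite cardinal and let G be a graph. Then G admits a λ-decomposition if and only if G admits both a λ-packing and a λ-covering. -/
universe u
open Cardinal

/-- `T` is a spanning tree of `G`: a connected, acyclic subgraph of `G`
containing all vertices of `G` (as `T` lives on the same vertex type `V`,
connectedness of `T` already makes it spanning). -/
def IsSpanningTree {V : Type u} (G T : SimpleGraph V) : Prop :=
  T ≤ G ∧ T.IsTree

/-- A λ-packing of `G`: a family of λ many pairwise edge-disjoint spanning trees. -/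
def HasPacking {V : Type u} (G : SimpleGraph V) (lam : Cardinal.{u}) : Prop :=
  ∃ (ι : Type u) (T : ι → SimpleGraph V), #ι = lam ∧
    (∀ i, IsSpanningTree G (T i)) ∧
    Pairwise (fun i j => Disjoint (T i).edgeSet (T j).edgeSet)

/-- A λ-covering of `G`: a family of λ many spanning trees whose edge sets cover the edge set of `G`. -/
def HasCovering {V : Type u} (G : SimpleGraph V) (lam : Cardinal.{u}) : Prop :=
  ∃ (ι : Type u) (T : ι → SimpleGraph V), #ι = lam ∧
    (∀ i, IsSpanningTree G (T i)) ∧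
    (⋃ i, (T i).edgeSet) = G.edgeSet

/-- A λ-decomposition of `G`: a family of λ many spanning trees whose edge sets
partition the edge set of `G`. -/
def HasDecomposition {V : Type u} (G : SimpleGraph V) (lam : Cardinal.{u}) : Prop :=
  ∃ (ι : Type u) (T : ι → SimpleGraph V), #ι = lam ∧
    (∀ i, IsSpanningTree G (T i)) ∧
    (Pairwise (fun i j => Disjoint (T i).edgeSet (T j).edgeSet)) ∧
    (⋃ i, (T i).edgeSet) = G.edgeSet

/-- `p` maps every vertex other than `r` to a `G`-neighbour, and iterating `p` leads from every
vertex to `r`, which is fixed: the parent map of a spanning tree of `G` rooted at `r`. -/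
structure IsParentMap {V : Type u} (G : SimpleGraph V) (r : V) (p : V → V) : Prop where
  root : p r = r
  adj : ∀ v, v ≠ r → G.Adj v (p v)
  reach : ∀ v, ∃ n, p^[n] v = r

/-- The graph joining every vertex to its image under `p`. -/
def parentGraph {V : Type u} (p : V → V) : SimpleGraph V :=
  SimpleGraph.fromRel fun a b => p a = b

namespace IsParentMap

variable {V : Type u} {G : SimpleGraph V} {r : V} {p : V → V}

lemma eq_root_of_iterate_succ_eq (h : IsParentMap G r p) {v : V} {n : ℕ}
    (hv : p^[n] (p v) = v) : v = r := by
  obtain ⟨k, hk⟩ := h.reach v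
  have hper : p^[(n + 1) * k] v = v := by
    rw [Function.iterate_mul]
    exact Function.iterate_fixed (by rwa [Function.iterate_succ_apply]) k
  rw [← hper, add_one_mul, Function.iterate_add_apply, hk]
  exact Function.iterate_fixed h.root _

lemma parent_ne (h : IsParentMap G r p) {v : V} (hv : v ≠ r) : p v ≠ v :=
  (h.adj v hv).ne'

lemma eq_of_edge_eq (h : IsParentMap G r p) {v w : V} (hv : v ≠ r)
    (he : s(v, p v) = s(w, p w)) : v = w := by
  rcases Sym2.eq_iff.1 he with ⟨h1, -⟩ | ⟨h1, h2⟩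
  · exact h1
  · exact absurd (h.eq_root_of_iterate_succ_eq (v := v) (n := 1) (by simp [h2, ← h1])) hv

lemma mem_edgeSet_iff (h : IsParentMap G r p) {e : Sym2 V} :
    e ∈ (parentGraph p).edgeSet ↔ ∃ v, v ≠ r ∧ e = s(v, p v) := by
  induction e with | _ a b =>
  simp only [SimpleGraph.mem_edgeSet, parentGraph, SimpleGraph.fromRel_adj]
  constructor
  · rintro ⟨hab, rfl | rfl⟩
    · exact ⟨a, fun hr => hab (by rw [hr, h.root]), rfl⟩
    · exact ⟨b, fun hr => hab (by rw [hr, h.root]), Sym2.eq_swap⟩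
  · rintro ⟨v, hv, he⟩
    have := h.parent_ne hv
    rcases Sym2.eq_iff.1 he with ⟨rfl, rfl⟩ | ⟨rfl, rfl⟩
    · exact ⟨this.symm, Or.inl rfl⟩
    · exact ⟨this, Or.inr rfl⟩

lemma parentGraph_le (h : IsParentMap G r p) : parentGraph p ≤ G := by
  rw [← SimpleGraph.edgeSet_subset_edgeSet]
  intro e he
  obtain ⟨v, hv, rfl⟩ := h.mem_edgeSet_iff.1 he
  exact h.adj v hv

lemma reachable_iterate (p : V → V) (v : V) (n : ℕ) :
    (parentGraph p).Reachable v (p^[n] v) := by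
  induction n with
  | zero => exact .refl _
  | succ n ih =>
    refine ih.trans ?_
    rw [Function.iterate_succ_apply']
    by_cases hn : p (p^[n] v) = p^[n] v
    · rw [hn]
    · exact SimpleGraph.Adj.reachable ⟨Ne.symm hn, Or.inl rfl⟩

lemma isTree (h : IsParentMap G r p) : (parentGraph p).IsTree := by
  have hroot : ∀ v, (parentGraph p).Reachable v r := fun v => by
    obtain ⟨n, hn⟩ := h.reach v
    exact hn ▸ reachable_iterate p v n
  have : Nonempty V := ⟨r⟩
  refine ⟨⟨fun u v => (hroot u).trans (hroot v).symm⟩, ?_⟩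
  rw [SimpleGraph.isAcyclic_iff_forall_isBridge]
  intro e he
  obtain ⟨v, hv, rfl⟩ := h.mem_edgeSet_iff.1 he
  rw [SimpleGraph.isBridge_iff]
  rintro ⟨w⟩
  have key : ∀ {a b : V}, ((parentGraph p).deleteEdges {s(v, p v)}).Walk a b →
      (∃ n, p^[n] a = v) → ∃ n, p^[n] b = v := by
    intro a b w
    induction w with
    | nil => exact id
    | @cons a c b hac w ih =>
      rintro ⟨n, hn⟩
      refine ih ?_
      rw [SimpleGraph.deleteEdges_adj] at hac
      obtain ⟨⟨hne, rfl | rfl⟩, hdel⟩ := hac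
      · cases n with
        | zero => exact absurd (by simp_all) hdel
        | succ n => exact ⟨n, hn⟩
      · exact ⟨n + 1, hn⟩
  obtain ⟨n, hn⟩ := key w ⟨0, rfl⟩
  exact hv (h.eq_root_of_iterate_succ_eq hn)

lemma isSpanningTree (h : IsParentMap G r p) : IsSpanningTree G (parentGraph p) :=
  ⟨h.parentGraph_le, h.isTree⟩

end IsParentMap

lemma SimpleGraph.IsTree.exists_parentMap {V : Type u} {T : SimpleGraph V} (hT : T.IsTree)
    (r : V) : ∃ p, IsParentMap T r p ∧ parentGraph p = T := by
  have hex : ∀ v, ∃ w, (v = r → w = r) ∧ (v ≠ r → T.Adj v w ∧ T.dist r v = T.dist r w + 1) := by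
    intro v
    by_cases hv : v = r
    · exact ⟨r, by simp [hv]⟩
    obtain ⟨w, hw⟩ := (hT.connected v r).exists_walk_length_eq_dist
    cases w with
    | nil => exact absurd rfl hv
    | @cons _ c _ hac w =>
      refine ⟨c, fun h => absurd h hv, fun _ => ⟨hac, ?_⟩⟩
      rcases hT.dist_eq_dist_add_one_of_adj r hac with h | h
      · exact h
      · have := T.dist_le w
        rw [SimpleGraph.dist_comm (u := v)] at hw
        rw [SimpleGraph.dist_comm (u := c)] at this
        rw [SimpleGraph.Walk.length_cons] at hw
        omega
  choose p hp hp' using hex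
  have huniq : ∀ {v w w'}, T.Adj v w → T.Adj v w' → T.dist r v = T.dist r w + 1 →
      T.dist r v = T.dist r w' + 1 → w = w' := by
    intro v w w' hw hw' hd hd'
    obtain ⟨q, hq⟩ := (hT.connected r w).exists_walk_length_eq_dist
    obtain ⟨q', hq'⟩ := (hT.connected r w').exists_walk_length_eq_dist
    have h1 : (q.concat hw.symm).IsPath :=
      SimpleGraph.Walk.isPath_of_length_eq_dist _ (by rw [SimpleGraph.Walk.length_concat, hq, hd])
    have h2 : (q'.concat hw'.symm).IsPath :=
      SimpleGraph.Walk.isPath_of_length_eq_dist _ (by rw [SimpleGraph.Walk.length_concat, hq', hd'])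
    have h3 := (hT.existsUnique_path r v).unique h1 h2
    simpa using congrArg SimpleGraph.Walk.penultimate h3
  have hroot : p r = r := hp r rfl
  have hne : ∀ {v w}, T.dist r v = T.dist r w + 1 → v ≠ r := by
    rintro v w h rfl
    simp at h
  refine ⟨p, ⟨hroot, fun v hv => (hp' v hv).1, ?_⟩, ?_⟩
  · intro v
    induction hn : T.dist r v generalizing v with
    | zero => exact ⟨0, ((hT.connected.dist_eq_zero_iff).1 hn).symm⟩
    | succ n ih =>
      by_cases hv : v = r
      · exact ⟨0, hv⟩
      obtain ⟨k, hk⟩ := ih (p v) (by have := (hp' v hv).2; omega)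
      exact ⟨k + 1, hk⟩
  · ext a b
    rw [parentGraph, SimpleGraph.fromRel_adj]
    constructor
    · rintro ⟨hab, rfl | rfl⟩
      · exact (hp' a fun h => hab (by rw [h, hroot])).1
      · exact (hp' b fun h => hab (by rw [h, hroot])).1.symm
    · intro hab
      refine ⟨hab.ne, ?_⟩
      rcases hT.dist_eq_dist_add_one_of_adj r hab with h | h
      · have := hp' a (hne h)
        exact Or.inl (huniq this.1 hab this.2 h)
      · have := hp' b (hne h)
        exact Or.inr (huniq this.1 hab.symm this.2 h)

/-- Redirecting at most one parent per level of a rank function that never increases towards the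
root, never to a descendant, keeps the root reachable from everywhere. -/
lemma reach_of_swap {V : Type u} {W : Type*} [LinearOrder W] [WellFoundedLT W] {p p' : V → V}
    {r : V} (ρ : V → W) (hρ : ∀ v, ρ (p v) ≤ ρ v) (hreach : ∀ v, ∃ n, p^[n] v = r)
    (h : ∀ v, p' v = p v ∨ (ρ (p' v) ≤ ρ v ∧ (∀ n, p^[n] (p' v) ≠ v) ∧
      ∀ w, ρ w = ρ v → w ≠ v → p' w = p w)) (v : V) : ∃ n, p'^[n] v = r := by
  have step : ∀ v, (∃ n, p'^[n] (p' v) = r) → ∃ n, p'^[n] v = r :=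
    fun v ⟨n, hn⟩ => ⟨n + 1, hn⟩
  induction hα : ρ v using WellFoundedLT.induction generalizing v with | _ α ih =>
  subst hα
  have climb : ∀ x, (∀ w, ρ w = ρ v → w ≠ x → p' w = p w) → ∀ n w, ρ w ≤ ρ v → p^[n] w = r →
      (∀ m, p^[m] w = x → ∃ k, p'^[k] x = r) → ∃ k, p'^[k] w = r := by
    intro x heq n
    induction n with
    | zero => exact fun w _ hw _ => ⟨0, hw⟩
    | succ n ihn =>
      intro w hle hw hx
      by_cases hwx : w = x
      · exact hwx ▸ hx 0 hwx
      rcases hle.lt_or_eq with hlt | hle'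
      · exact ih _ hlt w rfl
      · refine step w ?_
        rw [heq w hle' hwx]
        exact ihn (p w) ((hρ w).trans hle) hw (fun m => hx (m + 1))
  obtain ⟨n, hn⟩ := hreach v
  by_cases hsw : ∃ x, ρ x = ρ v ∧ p' x ≠ p x
  · obtain ⟨x, hx, hne⟩ := hsw
    obtain ⟨h1, h2, h3⟩ := (h x).resolve_left hne
    rw [hx] at h1 h3
    obtain ⟨m, hm⟩ := hreach (p' x)
    have hxr := step x (climb x h3 m (p' x) h1 hm fun k hk => absurd hk (h2 k))
    exact climb x h3 n v le_rfl hn fun _ _ => hxr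
  · push Not at hsw
    exact climb r (fun w hw _ => hsw w hw) n v le_rfl hn fun _ _ => ⟨0, rfl⟩

/-- Every family of self-maps of `V` admits a well-ordered rank function that no map of the family
increases and whose level sets are no larger than the (infinite) index type. -/
lemma exists_rank {V ι : Type u} [LinearOrder V] [WellFoundedLT V] [Infinite ι]
    (f : ι → V → V) : ∃ ρ : V → V, (∀ i v, ρ (f i v) ≤ ρ v) ∧ ∀ α, #{v // ρ v = α} ≤ #ι := by
  have hne : ∀ v, {u | ∃ l : List ι, l.foldr f u = v}.Nonempty := fun v => ⟨v, [], rfl⟩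
  let ρ : V → V := fun v => wellFounded_lt.min _ (hne v)
  have hρ : ∀ v, ∃ l : List ι, l.foldr f (ρ v) = v := fun v => wellFounded_lt.min_mem _ (hne v)
  refine ⟨ρ, fun i v => ?_, fun α => ?_⟩
  · obtain ⟨l, hl⟩ := hρ v
    exact wellFounded_lt.min_le (s := {u | ∃ l : List ι, l.foldr f u = f i v})
      ⟨i :: l, by rw [List.foldr_cons, hl]⟩
  · choose l hl using hρ
    rw [← mk_list_eq_mk ι]
    refine mk_le_of_injective (f := fun v : {v // ρ v = α} => l v) fun v w hvw => ?_
    refine Subtype.ext ?_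
    rw [← hl v, ← hl w, v.2, w.2]
    exact congrArg (List.foldr f α) hvw

section Exchange

variable {V : Type u} {G : SimpleGraph V} {r : V}

/-- An edge none of whose ends outranks `a` can be added to a tree by redirecting the parent of
one of its ends, of the same rank as `a`, to the other. -/
lemma IsParentMap.exists_orientation [LinearOrder V] {p : V → V} (hp : IsParentMap G r p)
    {ρ : V → V} (hρ : ∀ v, ρ (p v) ≤ ρ v) {a b : V} (hab : a ≠ b) (hle : ρ b ≤ ρ a) :
    ∃ x y, s(x, y) = s(a, b) ∧ ρ x = ρ a ∧ ρ y ≤ ρ x ∧ ∀ n, p^[n] y ≠ x := by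
  have hit : ∀ n v, ρ (p^[n] v) ≤ ρ v := by
    intro n
    induction n with
    | zero => exact fun v => le_rfl
    | succ n ih => exact fun v => (ih (p v)).trans (hρ v)
  by_cases hdesc : ∃ n, p^[n] b = a
  · obtain ⟨n, rfl⟩ := hdesc
    refine ⟨b, p^[n] b, Sym2.eq_swap, hle.antisymm (hit n b), hit n b, fun m hm => hab ?_⟩
    cases n with
    | zero => rfl
    | succ n =>
      rw [Function.iterate_succ_apply, ← Function.iterate_add_apply] at hm
      rw [hp.eq_root_of_iterate_succ_eq hm]
      exact Function.iterate_fixed hp.root _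
  · push Not at hdesc
    exact ⟨a, b, rfl, rfl, hle, hdesc⟩

lemma IsParentMap.ne_root_of_forall_iterate_ne {p : V → V} (hp : IsParentMap G r p) {x y : V}
    (h : ∀ n, p^[n] y ≠ x) : x ≠ r := by
  rintro rfl
  obtain ⟨n, hn⟩ := hp.reach y
  exact h n hn

/-- Starting from an edge `ab`, one can successively insert an edge into the tree with parent map
`p n`, which pushes out another edge to be inserted into the next tree, without changing rank. -/
lemma exists_exchange_sequence [LinearOrder V] {p : ℕ → V → V}
    (hp : ∀ n, IsParentMap G r (p n)) {ρ : V → V} (hρ : ∀ n v, ρ (p n v) ≤ ρ v) {a b : V}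
    (hab : a ≠ b) (hle : ρ b ≤ ρ a) :
    ∃ x y : ℕ → V, s(x 0, y 0) = s(a, b) ∧
      (∀ n, s(x (n + 1), y (n + 1)) = s(x n, p n (x n))) ∧
      (∀ n, ρ (x n) = ρ a) ∧ (∀ n, ρ (y n) ≤ ρ (x n)) ∧ ∀ n m, (p n)^[m] (y n) ≠ x n := by
  let State := {c : V × V // c.1 ≠ c.2 ∧ ρ c.2 ≤ ρ c.1 ∧ ρ c.1 = ρ a}
  have hor : ∀ n (c : State), ∃ x y, s(x, y) = s(c.1.1, c.1.2) ∧ ρ x = ρ c.1.1 ∧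
      ρ y ≤ ρ x ∧ ∀ m, (p n)^[m] y ≠ x :=
    fun n c => (hp n).exists_orientation (hρ n) c.2.1 c.2.2.1
  choose X Y hXY hX hY hnd using hor
  let next : ℕ → State → State := fun n c => ⟨(X n c, p n (X n c)),
    ((hp n).parent_ne ((hp n).ne_root_of_forall_iterate_ne (hnd n c))).symm,
    hρ n _, (hX n c).trans c.2.2.2⟩
  let st : ℕ → State := fun n => n.rec ⟨(a, b), hab, hle, rfl⟩ next
  exact ⟨fun n => X n (st n), fun n => Y n (st n), hXY 0 (st 0), fun n => hXY (n + 1) (st (n + 1)),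
    fun n => (hX n _).trans (st n).2.2.2, fun n => hY n _, fun n => hnd n _⟩

/-- If the edges outside a packing can be pushed along exchange sequences that use every tree at
most once on each level, then all edges can be absorbed into the packing. -/
lemma exists_parentMaps_of_exchange [LinearOrder V] [WellFoundedLT V] {ι L : Type*}
    {p : ι → V → V} (hp : ∀ i, IsParentMap G r (p i)) {ρ : V → V} (hρ : ∀ i v, ρ (p i v) ≤ ρ v)
    (hdisj : Pairwise fun i j =>
      Disjoint (parentGraph (p i)).edgeSet (parentGraph (p j)).edgeSet)
    {φ : L → ℕ → ι} {x y : L → ℕ → V}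
    (hsurj : ∀ e ∈ G.edgeSet, (∀ i, e ∉ (parentGraph (p i)).edgeSet) → ∃ l, s(x l 0, y l 0) = e)
    (hinj : ∀ l l', s(x l 0, y l 0) = s(x l' 0, y l' 0) → l = l')
    (hG : ∀ l, s(x l 0, y l 0) ∈ G.edgeSet)
    (hout : ∀ l i, s(x l 0, y l 0) ∉ (parentGraph (p i)).edgeSet)
    (hsucc : ∀ l n, s(x l (n + 1), y l (n + 1)) = s(x l n, p (φ l n) (x l n)))
    (hle : ∀ l n, ρ (y l n) ≤ ρ (x l n))
    (hnd : ∀ l n m, (p (φ l n))^[m] (y l n) ≠ x l n)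
    (hφ : ∀ l n l' n', φ l n = φ l' n' → ρ (x l n) = ρ (x l' n') → l = l' ∧ n = n') :
    ∃ p' : ι → V → V, (∀ i, IsParentMap G r (p' i)) ∧
      (Pairwise fun i j => Disjoint (parentGraph (p' i)).edgeSet (parentGraph (p' j)).edgeSet) ∧
      (⋃ i, (parentGraph (p' i)).edgeSet) = G.edgeSet := by
  classical
  have hxr : ∀ l n, x l n ≠ r := fun l n => (hp _).ne_root_of_forall_iterate_ne (hnd l n)
  have hmem : ∀ i v, v ≠ r → s(v, p i v) ∈ (parentGraph (p i)).edgeSet :=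
    fun i v hv => (hp i).mem_edgeSet_iff.2 ⟨v, hv, rfl⟩
  have huniq : ∀ {i j v w}, v ≠ r → w ≠ r → s(v, p i v) = s(w, p j w) → i = j ∧ v = w := by
    intro i j v w hv hw he
    have hij : i = j := by
      by_contra hij
      exact Set.disjoint_left.1 (hdisj hij) (hmem i v hv) (he ▸ hmem j w hw)
    subst hij
    exact ⟨rfl, (hp i).eq_of_edge_eq hv he⟩
  have hxG : ∀ l n, s(x l n, y l n) ∈ G.edgeSet := by
    intro l n
    cases n with
    | zero => exact hG l
    | succ n => exact hsucc l n ▸ (hp _).adj _ (hxr l n)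
  let p' : ι → V → V := fun i v =>
    if h : ∃ k : L × ℕ, φ k.1 k.2 = i ∧ x k.1 k.2 = v then y h.choose.1 h.choose.2 else p i v
  have hp'_swap : ∀ l n, p' (φ l n) (x l n) = y l n := by
    intro l n
    have h : ∃ k : L × ℕ, φ k.1 k.2 = φ l n ∧ x k.1 k.2 = x l n := ⟨(l, n), rfl, rfl⟩
    obtain ⟨h1, h2⟩ := hφ _ _ _ _ h.choose_spec.1 (congrArg ρ h.choose_spec.2)
    simp only [p', dif_pos h, h1, h2]
  have hp'_keep : ∀ i v, (∀ l n, φ l n = i → x l n ≠ v) → p' i v = p i v :=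
    fun i v h => dif_neg fun ⟨k, h1, h2⟩ => h k.1 k.2 h1 h2
  have hcases : ∀ i v, (∃ l n, φ l n = i ∧ x l n = v) ∨ ∀ l n, φ l n = i → x l n ≠ v := by
    intro i v
    by_contra! h
    obtain ⟨h1, l, n, h2, h3⟩ := h
    exact h1 l n h2 h3
  have hp' : ∀ i, IsParentMap G r (p' i) := by
    refine fun i => ⟨?_, fun v hv => ?_, ?_⟩
    · rw [hp'_keep i r fun l n _ => hxr l n, (hp i).root]
    · rcases hcases i v with ⟨l, n, rfl, rfl⟩ | h
      · rw [hp'_swap]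
        exact hxG l n
      · rw [hp'_keep i v h]
        exact (hp i).adj v hv
    · refine reach_of_swap ρ (hρ i) (hp i).reach fun v => ?_
      rcases hcases i v with ⟨l, n, rfl, rfl⟩ | h
      · right
        rw [hp'_swap]
        refine ⟨hle l n, hnd l n, fun w hw hne => hp'_keep _ _ ?_⟩
        rintro l' n' he rfl
        obtain ⟨rfl, rfl⟩ := hφ _ _ _ _ he hw
        exact hne rfl
      · exact Or.inl (hp'_keep i v h)
  -- an exchanged edge never coincides with an edge that is kept by another tree
  have hmixed : ∀ l n j w, w ≠ r → (∀ l n, φ l n = j → x l n ≠ w) →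
      s(x l n, y l n) ≠ s(w, p j w) := by
    intro l n j w hw hkeep he
    cases n with
    | zero => exact hout l j (he ▸ hmem j w hw)
    | succ n =>
      obtain ⟨h1, h2⟩ := huniq (hxr l n) hw ((hsucc l n).symm.trans he)
      exact hkeep l n h1 h2
  have hexch : ∀ l n l' n', s(x l n, y l n) = s(x l' n', y l' n') → φ l n = φ l' n' := by
    intro l n l' n' he
    cases n with
    | zero =>
      cases n' with
      | zero => rw [hinj l l' he]
      | succ n' =>
        rw [hsucc] at he
        exact absurd (he ▸ hmem _ _ (hxr l' n')) (hout l _)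
    | succ n =>
      cases n' with
      | zero =>
        rw [hsucc] at he
        exact absurd (he ▸ hmem _ _ (hxr l n)) (hout l' _)
      | succ n' =>
        rw [hsucc, hsucc] at he
        obtain ⟨h1, h2⟩ := huniq (hxr l n) (hxr l' n') he
        obtain ⟨rfl, rfl⟩ := hφ _ _ _ _ h1 (congrArg ρ h2)
        rfl
  refine ⟨p', hp', fun i j hij => Set.disjoint_left.2 fun e hi hj => hij ?_, ?_⟩
  · obtain ⟨v, hv, rfl⟩ := (hp' i).mem_edgeSet_iff.1 hi
    obtain ⟨w, hw, he⟩ := (hp' j).mem_edgeSet_iff.1 hj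
    rcases hcases i v with ⟨l, n, rfl, rfl⟩ | h <;> rcases hcases j w with ⟨l', n', rfl, rfl⟩ | h'
    · rw [hp'_swap, hp'_swap] at he
      exact hexch _ _ _ _ he
    · rw [hp'_swap, hp'_keep j w h'] at he
      exact absurd he (hmixed _ _ _ _ hw h')
    · rw [hp'_swap, hp'_keep i v h] at he
      exact absurd he.symm (hmixed _ _ _ _ hv h)
    · rw [hp'_keep i v h, hp'_keep j w h'] at he
      exact (huniq hv hw he).1
  · have hcov : ∀ l n, s(x l n, y l n) ∈ ⋃ i, (parentGraph (p' i)).edgeSet := fun l n =>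
      Set.mem_iUnion.2 ⟨φ l n, (hp' _).mem_edgeSet_iff.2 ⟨x l n, hxr l n, by rw [hp'_swap]⟩⟩
    refine (Set.iUnion_subset fun i =>
      SimpleGraph.edgeSet_subset_edgeSet.2 (hp' i).parentGraph_le).antisymm fun e he => ?_
    by_cases h : ∀ i, e ∉ (parentGraph (p i)).edgeSet
    · obtain ⟨l, rfl⟩ := hsurj e he h
      exact hcov l 0
    · push Not at h
      obtain ⟨i, hi⟩ := h
      obtain ⟨v, hv, rfl⟩ := (hp i).mem_edgeSet_iff.1 hi
      rcases hcases i v with ⟨l, n, rfl, rfl⟩ | h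
      · exact hsucc l n ▸ hcov l (n + 1)
      · exact Set.mem_iUnion.2
          ⟨i, (hp' i).mem_edgeSet_iff.2 ⟨v, hv, by rw [hp'_keep i v h]⟩⟩

end Exchange

/-- For an infinite cardinal λ, a graph admits a λ-decomposition iff it admits both
a λ-packing and a λ-covering. -/
theorem decomposition_iff_packing_and_covering {V : Type u} (G : SimpleGraph V)
    (lam : Cardinal.{u}) (hlam : aleph0 ≤ lam) :
    HasDecomposition G lam ↔ HasPacking G lam ∧ HasCovering G lam := by
  constructor
  · rintro ⟨ι, T, hι, hT, hdisj, hcov⟩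
    exact ⟨⟨ι, T, hι, hT, hdisj⟩, ⟨ι, T, hι, hT, hcov⟩⟩
  rintro ⟨⟨ι, T, hι, hT, hdisj⟩, κ, S, hκ, hS, hcov⟩
  have : Infinite ι := infinite_iff.2 (hι ▸ hlam)
  obtain ⟨r⟩ := (hT (Classical.arbitrary ι)).2.connected.nonempty
  choose p hp hpT using fun i => (hT i).2.exists_parentMap r
  choose q hq hqS using fun j => (hS j).2.exists_parentMap r
  have hpG : ∀ i, IsParentMap G r (p i) :=
    fun i => ⟨(hp i).root, fun v hv => (hT i).1 ((hp i).adj v hv), (hp i).reach⟩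
  obtain ⟨_, _⟩ := exists_wellFoundedLT V
  obtain ⟨ρ, hρ, hρcard⟩ := exists_rank (Sum.elim p q)
  have hρp : ∀ i v, ρ (p i v) ≤ ρ v := fun i => hρ (Sum.inl i)
  have hρq : ∀ j v, ρ (q j v) ≤ ρ v := fun j => hρ (Sum.inr j)
  have hlevel : ∀ α, #{v // ρ v = α} ≤ lam := by
    intro α
    simpa [hι, hκ, add_eq_self hlam] using hρcard α
  let L := {e : Sym2 V // e ∈ G.edgeSet ∧ ∀ i, e ∉ (parentGraph (p i)).edgeSet}
  have hown : ∀ e : L, ∃ j v, v ≠ r ∧ e.1 = s(v, q j v) := by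
    intro e
    obtain ⟨j, hj⟩ := Set.mem_iUnion.1 (hcov.symm ▸ e.2.1 : e.1 ∈ ⋃ i, (S i).edgeSet)
    rw [← hqS j] at hj
    exact ⟨j, (hq j).mem_edgeSet_iff.1 hj⟩
  choose j a har he using hown
  have hemb : ∀ α, Nonempty ({e : L // ρ (a e) = α} × ℕ ↪ ι) := by
    intro α
    have h1 : #{e : L // ρ (a e) = α} ≤ lam := by
      calc #{e : L // ρ (a e) = α} ≤ #({v // ρ v = α} × κ) := by
            refine mk_le_of_injective (f := fun e => (⟨a e.1, e.2⟩, j e.1)) fun e e' h => ?_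
            simp only [Prod.mk.injEq, Subtype.mk.injEq] at h
            refine Subtype.ext (Subtype.ext ?_)
            rw [he, he, h.1, h.2]
        _ ≤ lam * lam := by
            rw [mk_prod, lift_id, lift_id, hκ]
            exact mul_le_mul_left (hlevel α) lam
        _ = lam := mul_eq_self hlam
    rw [← le_def, hι]
    calc #({e : L // ρ (a e) = α} × ℕ) ≤ lam * ℵ₀ := by
          simpa using mul_le_mul_left h1 ℵ₀
      _ = lam := mul_aleph0_eq hlam
  let ψ := fun α => (hemb α).some
  let φ : L → ℕ → ι := fun e n => ψ (ρ (a e)) (⟨e, rfl⟩, n)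
  have hφ : ∀ e n e' n', φ e n = φ e' n' → ρ (a e) = ρ (a e') → e = e' ∧ n = n' := by
    have hψ : ∀ e α (h : ρ (a e) = α) n, φ e n = ψ α (⟨e, h⟩, n) := by
      rintro e _ rfl n
      rfl
    intro e n e' n' h hα
    rw [hψ e _ hα, hψ e' _ rfl] at h
    simpa using (ψ _).injective h
  choose x y hxy hsucc hlev hle hnd using fun e : L =>
    exists_exchange_sequence (fun n => hpG (φ e n)) (fun n => hρp (φ e n))
      ((hq (j e)).parent_ne (har e)).symm (hρq (j e) (a e))
  have hxy' : ∀ e, s(x e 0, y e 0) = e.1 := fun e => (hxy e).trans (he e).symm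
  obtain ⟨p', hp', hdisj', hcov'⟩ := exists_parentMaps_of_exchange hpG hρp
    (by simpa only [hpT] using hdisj)
    (fun e he hi => ⟨⟨e, he, hi⟩, hxy' _⟩)
    (fun e e' h => Subtype.ext (by rwa [hxy', hxy'] at h))
    (fun e => hxy' e ▸ e.2.1) (fun e i => hxy' e ▸ e.2.2 i) hsucc hle hnd
    (fun e n e' n' h hl => hφ e n e' n' h (by rwa [hlev, hlev] at hl))
  exact ⟨ι, fun i => parentGraph (p' i), hι, fun i => (hp' i).isSpanningTree, hdisj', hcov'⟩
end

section
/- Let λ be an infinite cardinal. A graph G admits a λ-covering if and only if G is connected and the colouring number of G is at most λ⁺ (the cardinal successor of λ). -/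
universe u
open Cardinal

/-- The colouring number of `G`: the smallest cardinal `μ` such that there is a
well-ordering of `V` in which every vertex has strictly fewer than `μ` edges to
earlier vertices (in a simple graph, edges from `v` to earlier vertices correspond
to earlier neighbours of `v`). -/
noncomputable def colNumber {V : Type u} (G : SimpleGraph V) : Cardinal.{u} :=
  sInf {μ : Cardinal.{u} | ∃ r : V → V → Prop, IsWellOrder V r ∧
    ∀ v, #{w : V // r w v ∧ G.Adj w v} < μ}

/-- The tree neighbour of a vertex on the path to a fixed root: every edge of a tree joins
a vertex to its parent. -/
theorem SimpleGraph.IsTree.exists_parent {V : Type*} {T : SimpleGraph V} (hT : T.IsTree) :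
    ∃ p : V → V, ∀ v w, T.Adj v w → w = p v ∨ v = p w := by
  obtain ⟨root⟩ := hT.nonempty
  choose q hq using fun v => (hT.existsUnique_path root v).exists
  refine ⟨fun v => (q v).penultimate, fun v w h => ?_⟩
  by_cases hw : w ∈ (q v).support
  · exact Or.inl (hT.isAcyclic.eq_penultimate_of_adj_end (hq v) h hw)
  · refine Or.inr (hT.isAcyclic.eq_penultimate_of_adj_end (hq w) h.symm ?_)
    exact hT.isAcyclic.mem_support_of_ne_mem_support_of_adj_of_isPath (hq w) (hq v) h.symm hw

/-- If every vertex has at most one earlier neighbour with respect to a strict linear order,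
then the graph is acyclic. -/
theorem SimpleGraph.isAcyclic_of_subsingleton_earlier {V : Type*} {F : SimpleGraph V}
    (r : V → V → Prop) [IsStrictTotalOrder V r]
    (h : ∀ v w w', F.Adj v w → F.Adj v w' → r w v → r w' v → w = w') : F.IsAcyclic := by
  classical
  let _ := linearOrderOfSTO r
  intro v c hc
  obtain ⟨m, hm, hmax⟩ := c.support.toFinset.exists_max_image id ⟨v, by simp⟩
  rw [List.mem_toFinset] at hm
  have hlt : ∀ w ∈ (c.rotate m hm).support, F.Adj m w → r w m := fun w hw hadj => by
    have hw' : w ∈ c.support.toFinset := by simpa using hw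
    exact lt_of_le_of_ne (hmax w hw') hadj.ne'
  have hc' := hc.rotate hm
  have h1 := Walk.adj_snd hc'.not_nil
  have h2 := (Walk.adj_penultimate hc'.not_nil).symm
  exact hc'.snd_ne_penultimate (h _ _ _ h1 h2
    (hlt _ (Walk.getVert_mem_support _ _) h1)
    (hlt _ (Walk.getVert_mem_support _ _) h2))

theorem colNumber_le_succ_iff {V : Type u} (G : SimpleGraph V) (lam : Cardinal.{u}) :
    colNumber G ≤ Order.succ lam ↔ ∃ r : V → V → Prop, IsWellOrder V r ∧
      ∀ v, #{w : V // r w v ∧ G.Adj w v} ≤ lam := by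
  constructor
  · intro h
    have hne : {μ : Cardinal.{u} | ∃ r : V → V → Prop, IsWellOrder V r ∧
        ∀ v, #{w : V // r w v ∧ G.Adj w v} < μ}.Nonempty :=
      ⟨Order.succ #V, WellOrderingRel, inferInstance,
        fun v => Order.lt_succ_iff.2 (mk_subtype_le _)⟩
    obtain ⟨r, hr, hlt⟩ := csInf_mem hne
    exact ⟨r, hr, fun v => Order.lt_succ_iff.1 ((hlt v).trans_le h)⟩
  · rintro ⟨r, hr, hle⟩
    exact csInf_le' ⟨r, hr, fun v => Order.lt_succ_iff.2 (hle v)⟩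

/-- If every edge of `G` is of the form `v, out i v` for one of at most `lam` many functions
`out i`, then `G` has a well-ordering with at most `lam` earlier neighbours of each vertex. -/
theorem exists_wellOrder_of_out {V ι : Type u} (G : SimpleGraph V) {lam : Cardinal.{u}}
    (hlam : aleph0 ≤ lam) (hι : #ι ≤ lam) (out : ι → V → V)
    (hout : ∀ v w, G.Adj v w → ∃ i, w = out i v ∨ v = out i w) :
    ∃ r : V → V → Prop, IsWellOrder V r ∧ ∀ v, #{w : V // r w v ∧ G.Adj w v} ≤ lam := by
  let cl : V → Set V := fun v => Set.range fun l : List ι => l.foldl (fun x i => out i x) v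
  have self_mem (v : V) : v ∈ cl v := ⟨[], rfl⟩
  have out_mem {v w : V} (i : ι) (h : w ∈ cl v) : out i w ∈ cl v := by
    obtain ⟨l, rfl⟩ := h
    exact ⟨l ++ [i], by simp⟩
  have mk_cl (v : V) : #(cl v) ≤ lam :=
    mk_range_le.trans ((mk_list_le_max ι).trans (max_le hlam hι))
  obtain ⟨_, _⟩ := exists_wellFoundedLT V
  let f : V → V := fun v => wellFounded_lt.min {u | v ∈ cl u} ⟨v, self_mem v⟩
  have mem_f (v : V) : v ∈ cl (f v) := wellFounded_lt.min_mem {u | v ∈ cl u} _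
  have f_le {u v : V} (h : v ∈ cl u) : f v ≤ u := not_lt.1 (wellFounded_lt.not_lt_min {u | v ∈ cl u} h)
  let e : V ↪ V ×ₗ V := ⟨fun v => toLex (f v, v), fun v w h => congrArg Prod.snd (toLex_inj.1 h)⟩
  refine ⟨e ⁻¹'o (· < ·), (RelEmbedding.preimage e (· < ·)).isWellOrder, fun v => ?_⟩
  have hsub : {w | (e ⁻¹'o (· < ·)) w v ∧ G.Adj w v} ⊆ Set.range (out · v) ∪ cl (f v) := by
    rintro w ⟨hlt, hadj⟩
    obtain ⟨i, rfl | rfl⟩ := hout w v hadj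
    · refine Or.inr ?_
      have h1 : f w ≤ f (out i w) := by
        rcases Prod.Lex.toLex_lt_toLex.1 hlt with h | h
        · exact h.le
        · exact h.1.le
      have h2 : f (out i w) ≤ f w := f_le (out_mem i (mem_f w))
      rw [← le_antisymm h1 h2]
      exact mem_f w
    · exact Or.inl ⟨i, rfl⟩
  exact (mk_le_mk_of_subset hsub).trans ((mk_union_le _ _).trans
    (add_le_of_le hlam (mk_range_le.trans hι) (mk_cl _)))

/-- A connected graph with a well-ordering in which every vertex has at most `lam` earlier
neighbours has a `lam`-covering. -/
theorem hasCovering_of_wellOrder {V : Type u} {G : SimpleGraph V} {lam : Cardinal.{u}}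
    (hG : G.Connected) (r : V → V → Prop) [IsWellOrder V r]
    (hr : ∀ v, #{w : V // r w v ∧ G.Adj w v} ≤ lam) : HasCovering G lam := by
  have hcode (v : V) : Nonempty ({w : V // r w v ∧ G.Adj w v} ↪ lam.out) := by
    rw [← le_def, mk_out]
    exact hr v
  let code (v : V) := (hcode v).some
  let F (i : lam.out) : SimpleGraph V := SimpleGraph.fromRel fun v w =>
    ∃ h : r w v ∧ G.Adj w v, code v ⟨w, h⟩ = i
  have F_le (i) : F i ≤ G := by
    rintro v w ⟨-, ⟨h, -⟩ | ⟨h, -⟩⟩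
    exacts [h.2.symm, h.2]
  have code_eq {i v w} (h : (F i).Adj v w) (hwv : r w v) :
      ∃ h : r w v ∧ G.Adj w v, code v ⟨w, h⟩ = i := by
    obtain ⟨-, h | ⟨h, -⟩⟩ := h
    exacts [h, (asymm hwv h.1).elim]
  have F_acyclic (i) : (F i).IsAcyclic :=
    SimpleGraph.isAcyclic_of_subsingleton_earlier r fun v w w' h h' hw hw' => by
      obtain ⟨_, rfl⟩ := code_eq h hw
      obtain ⟨_, he⟩ := code_eq h' hw'
      exact congrArg Subtype.val ((code v).injective he.symm)
  choose T hFT hTG hT using fun i => hG.exists_isTree_le_of_le_of_isAcyclic (F_le i) (F_acyclic i)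
  refine ⟨lam.out, T, mk_out lam, fun i => ⟨hTG i, hT i⟩, Set.Subset.antisymm
    (Set.iUnion_subset fun i => SimpleGraph.edgeSet_mono (hTG i)) fun e he => ?_⟩
  induction e with | _ v w
  have hvw : G.Adj v w := he
  rw [Set.mem_iUnion]
  rcases trichotomous_of r v w with h | h | h
  · exact ⟨code w ⟨v, h, hvw⟩, hFT _ ⟨hvw.ne, Or.inr ⟨⟨h, hvw⟩, rfl⟩⟩⟩
  · exact (hvw.ne h).elim
  · exact ⟨code v ⟨w, h, hvw.symm⟩, hFT _ ⟨hvw.ne, Or.inl ⟨⟨h, hvw.symm⟩, rfl⟩⟩⟩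

/-- Erdős–Hajnal: for an infinite cardinal λ, a graph admits a λ-covering iff it is
connected and has colouring number at most λ⁺ (the cardinal successor of λ). -/
theorem covering_iff_connected_and_col {V : Type u} (G : SimpleGraph V)
    (lam : Cardinal.{u}) (hlam : aleph0 ≤ lam) :
    HasCovering G lam ↔ G.Connected ∧ colNumber G ≤ Order.succ lam := by
  rw [colNumber_le_succ_iff]
  constructor
  · rintro ⟨ι, T, hι, hT, hcov⟩
    have : Nonempty ι := mk_ne_zero_iff.1 (hι ▸ (aleph0_pos.trans_le hlam).ne')
    let i := Classical.arbitrary ι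
    refine ⟨(hT i).2.connected.mono (hT i).1, ?_⟩
    choose out hout using fun i => (hT i).2.exists_parent
    refine exists_wellOrder_of_out G hlam hι.le out fun v w h => ?_
    have h' : s(v, w) ∈ ⋃ i, (T i).edgeSet := hcov ▸ h
    obtain ⟨i, hi⟩ := Set.mem_iUnion.1 h'
    exact ⟨i, hout i v w hi⟩
  · rintro ⟨hG, r, _, hr⟩
    exact hasCovering_of_wellOrder hG r hr
end

section
/- Let λ be an infinite cardinal and let G be a connected graph. If there exists a well-ordering <* of the vertex set of G such that every vertex v has at most λ many edges joining it to vertices preceding v in <*, then G admits a λ-covering, i.e., a family of λ many spanning trees whose edge sets together cover the edge set of G. -/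
universe u
open Cardinal

/-- A graph on a linear order in which every vertex has at most one smaller neighbor is a
forest. -/
theorem SimpleGraph.isAcyclic_of_smaller_neighbor_unique {V : Type*} [LinearOrder V]
    {F : SimpleGraph V}
    (hF : ∀ ⦃v a b⦄, F.Adj a v → F.Adj b v → a < v → b < v → a = b) : F.IsAcyclic := by
  intro u p hp
  obtain ⟨m, hm, hmax⟩ := p.support.toFinset.exists_max_image id ⟨u, by simp⟩
  simp only [List.mem_toFinset, id] at hm hmax
  have hq := hp.rotate hm
  have hle : ∀ i, (p.rotate m hm).getVert i ≤ m := fun i =>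
    hmax _ ((p.mem_support_rotate_iff m hm).1 (Walk.getVert_mem_support _ i))
  have hs := (Walk.adj_snd hq.not_nil).symm
  have ht := Walk.adj_penultimate hq.not_nil
  exact hq.snd_ne_penultimate (hF hs ht ((hle _).lt_of_ne hs.ne) ((hle _).lt_of_ne ht.ne))

/-- If `G` is connected and there is a well-ordering of its vertex set in which every
vertex has at most λ many edges to earlier vertices (λ infinite), then `G` admits a
λ-covering. -/
theorem covering_of_wellOrder {V : Type u} (G : SimpleGraph V)
    (lam : Cardinal.{u}) (hlam : aleph0 ≤ lam) (hconn : G.Connected)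
    (h : ∃ r : V → V → Prop, IsWellOrder V r ∧
      ∀ v, #{w : V // r w v ∧ G.Adj w v} ≤ lam) :
    HasCovering G lam := by
  obtain ⟨r, hr, hcard⟩ := h
  classical
  let : LinearOrder V := linearOrderOfSTO r
  have hemb : ∀ v, Nonempty ({w : V // w < v ∧ G.Adj w v} ↪ lam.out) := fun v => by
    rw [← Cardinal.le_def, mk_out]
    exact hcard v
  let e := fun v => (hemb v).some
  let F : lam.out → SimpleGraph V := fun i =>
    SimpleGraph.fromRel fun a b => ∃ hab : a < b ∧ G.Adj a b, e b ⟨a, hab⟩ = i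
  have hFG : ∀ i, F i ≤ G := by
    rintro i a b ⟨-, ⟨hab, -⟩ | ⟨hab, -⟩⟩
    exacts [hab.2, hab.2.symm]
  have hcolor : ∀ {i a v}, (F i).Adj a v → a < v →
      ∃ hav : a < v ∧ G.Adj a v, e v ⟨a, hav⟩ = i := by
    rintro i a v ⟨-, hav | ⟨hva, -⟩⟩ hlt
    exacts [hav, (hva.1.asymm hlt).elim]
  have hacyclic : ∀ i, (F i).IsAcyclic := fun i =>
    SimpleGraph.isAcyclic_of_smaller_neighbor_unique fun v a b ha hb hav hbv => by
      obtain ⟨_, ha'⟩ := hcolor ha hav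
      obtain ⟨_, hb'⟩ := hcolor hb hbv
      exact congrArg Subtype.val ((e v).injective (ha'.trans hb'.symm))
  choose T hFT hTG hT using fun i => hconn.exists_isTree_le_of_le_of_isAcyclic (hFG i) (hacyclic i)
  refine ⟨lam.out, T, mk_out lam, fun i => ⟨hTG i, hT i⟩, Set.Subset.antisymm
    (Set.iUnion_subset fun i => SimpleGraph.edgeSet_mono (hTG i)) ?_⟩
  intro s
  induction s with | _ a b
  intro hab
  rw [SimpleGraph.mem_edgeSet] at hab
  simp only [Set.mem_iUnion, SimpleGraph.mem_edgeSet]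
  rcases hab.ne.lt_or_gt with hlt | hlt
  · exact ⟨_, hFT _ ⟨hab.ne, Or.inl ⟨⟨hlt, hab⟩, rfl⟩⟩⟩
  · exact ⟨_, hFT _ ⟨hab.ne, Or.inr ⟨⟨hlt, hab.symm⟩, rfl⟩⟩⟩
end

section
/- Let λ be an infinite cardinal and let G be a graph. If there exists a well-ordering <* of the vertex set of G such that every vertex v has at most λ many edges joining it to vertices preceding v in <*, then the edge set of G can be written as the union of λ many edge sets of acyclic subgraphs (forests) of G. -/
universe u
open Cardinal

/-- A graph is acyclic if, in some linear order of its vertices, every vertex has at most one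
smaller neighbour. -/
theorem SimpleGraph.isAcyclic_of_subsingleton_lt_adj {V : Type*} [LinearOrder V]
    {G : SimpleGraph V} (h : ∀ v, {w | w < v ∧ G.Adj w v}.Subsingleton) : G.IsAcyclic := by
  intro a c hc
  obtain ⟨v, hv, hmax⟩ := c.support.toFinset.exists_max_image id ⟨a, by simp⟩
  rw [List.mem_toFinset] at hv
  have hlt : ∀ w ∈ (c.rotate v hv).support, G.Adj w v → w < v := fun w hw hwv ↦
    lt_of_le_of_ne (hmax w (by simpa using hw)) hwv.ne
  have hcv := hc.rotate hv
  have hsnd := ((c.rotate v hv).adj_snd hcv.not_nil).symm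
  have hpen := (c.rotate v hv).adj_penultimate hcv.not_nil
  exact hcv.snd_ne_penultimate <| h v
    ⟨hlt _ (SimpleGraph.Walk.getVert_mem_support _ _) hsnd, hsnd⟩
    ⟨hlt _ (SimpleGraph.Walk.getVert_mem_support _ _) hpen, hpen⟩

/-- If λ is infinite and there is a well-ordering of the vertex set of `G` in which
every vertex has at most λ many edges to earlier vertices, then the edge set of `G`
is a union of the edge sets of λ many forests (acyclic subgraphs of `G`). -/
theorem forest_cover_of_wellOrder {V : Type u} (G : SimpleGraph V)
    (lam : Cardinal.{u}) (hlam : aleph0 ≤ lam)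
    (h : ∃ r : V → V → Prop, IsWellOrder V r ∧
      ∀ v, #{w : V // r w v ∧ G.Adj w v} ≤ lam) :
    ∃ (ι : Type u) (F : ι → SimpleGraph V), #ι = lam ∧
      (∀ i, F i ≤ G ∧ (F i).IsAcyclic) ∧
      (⋃ i, (F i).edgeSet) = G.edgeSet := by
  classical
  obtain ⟨r, hr, hcard⟩ := h
  let _ : LinearOrder V := linearOrderOfSTO r
  have hemb : ∀ v, Nonempty ({w : V // w < v ∧ G.Adj w v} ↪ lam.out) := fun v ↦ by
    rw [← Cardinal.le_def, mk_out]
    exact hcard v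
  let f v := (hemb v).some
  let F (i : lam.out) : SimpleGraph V :=
    { Adj a b := (∃ hab, f b ⟨a, hab⟩ = i) ∨ ∃ hba, f a ⟨b, hba⟩ = i
      symm := ⟨fun _ _ ↦ Or.symm⟩
      loopless := ⟨fun a ha ↦ by simp at ha⟩ }
  have hF : ∀ i, F i ≤ G := by
    rintro i a b (⟨hab, -⟩ | ⟨hba, -⟩)
    exacts [hab.2, hba.2.symm]
  refine ⟨lam.out, F, mk_out lam, fun i ↦ ⟨hF i, ?_⟩, ?_⟩
  · have hadj : ∀ {v w}, w < v → (F i).Adj w v → ∃ hw, f v ⟨w, hw⟩ = i := by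
      rintro v w hwv (hw | ⟨hv, -⟩)
      exacts [hw, absurd hv.1 hwv.asymm]
    refine SimpleGraph.isAcyclic_of_subsingleton_lt_adj fun v w ⟨hwv, hw⟩ x ⟨hxv, hx⟩ ↦ ?_
    obtain ⟨_, hfw⟩ := hadj hwv hw
    obtain ⟨_, hfx⟩ := hadj hxv hx
    exact congrArg Subtype.val ((f v).injective (hfw.trans hfx.symm))
  · refine Set.Subset.antisymm (Set.iUnion_subset fun i ↦ SimpleGraph.edgeSet_mono (hF i)) ?_
    rintro ⟨a, b⟩ hab
    rw [Set.mem_iUnion]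
    have hab : G.Adj a b := hab
    rcases hab.ne.lt_or_gt with hlt | hlt
    exacts [⟨_, Or.inl ⟨⟨hlt, hab⟩, rfl⟩⟩, ⟨_, Or.inr ⟨⟨hlt, hab.symm⟩, rfl⟩⟩]
end

section
/- Every graph G has a good well-ordering of its vertex set of order type |V(G)|; that is, there exists a well-ordering of V(G) of order type equal to the cardinality of V(G) which witnesses the colouring number of G: for every vertex v, the set of edges joining v to vertices preceding v in the well-ordering has cardinality strictly less than col(G). -/
universe u
open Cardinal

/-- If every vertex has finitely many predecessors under a well-founded relation, then it has
finitely many iterated predecessors. -/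
theorem WellFounded.finite_setOf_reflTransGen {V : Type u} {p : V → V → Prop}
    (hp : WellFounded p) (hfin : ∀ v, {w | p w v}.Finite) (v : V) :
    {w | Relation.ReflTransGen p w v}.Finite := by
  induction v using hp.induction with
  | _ v ih =>
    refine ((Set.finite_singleton v).union ((hfin v).biUnion ih)).subset ?_
    intro w hw
    rcases Relation.ReflTransGen.cases_tail hw with rfl | ⟨c, hwc, hcv⟩
    · exact Or.inl rfl
    · exact Or.inr (Set.mem_biUnion (x := c) hcv hwc)

/-- If every vertex has at most `c` predecessors under a well-founded relation, where `c` is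
infinite, then it has at most `c` iterated predecessors. -/
theorem WellFounded.mk_setOf_reflTransGen_le {V : Type u} {p : V → V → Prop}
    (hp : WellFounded p) {c : Cardinal.{u}} (hc : ℵ₀ ≤ c) (hle : ∀ v, #{w | p w v} ≤ c) (v : V) :
    #{w | Relation.ReflTransGen p w v} ≤ c := by
  induction v using hp.induction with
  | _ v ih =>
    have hsub : {w | Relation.ReflTransGen p w v} ⊆
        {v} ∪ ⋃ x ∈ {w | p w v}, {w | Relation.ReflTransGen p w x} := by
      intro w hw
      rcases Relation.ReflTransGen.cases_tail hw with rfl | ⟨c, hwc, hcv⟩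
      · exact Or.inl rfl
      · exact Or.inr (Set.mem_biUnion (x := c) hcv hwc)
    refine (mk_le_mk_of_subset hsub).trans ((mk_union_le _ _).trans ?_)
    refine add_le_of_le hc ?_ ((mk_biUnion_le _ _).trans (mul_le_of_le hc (hle v) ?_))
    · rw [mk_singleton]
      exact one_le_aleph0.trans hc
    · exact ciSup_le' fun x => ih x x.2

/-- Fewer than `κ` vertices have fewer than `κ` iterated predecessors in total, if the number of
predecessors of a vertex is bounded by some `μ < κ`. -/
theorem WellFounded.mk_biUnion_reflTransGen_lt {V : Type u} {p : V → V → Prop}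
    (hp : WellFounded p) {κ μ : Cardinal.{u}} (hκ : ℵ₀ ≤ κ) (hμ : μ < κ)
    (hlt : ∀ v, #{w | p w v} < μ) {S : Set V} (hS : #S < κ) :
    #(⋃ x ∈ S, {w | Relation.ReflTransGen p w x} : Set V) < κ := by
  rcases hκ.eq_or_lt with rfl | hκ'
  · rw [lt_aleph0_iff_set_finite] at hS ⊢
    exact hS.biUnion fun x _ => hp.finite_setOf_reflTransGen
      (fun v => lt_aleph0_iff_set_finite.1 ((hlt v).trans hμ)) x
  · refine (mk_biUnion_le _ _).trans_lt (mul_lt_of_lt hκ hS ?_)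
    refine (ciSup_le' fun x : S => hp.mk_setOf_reflTransGen_le (le_max_right μ ℵ₀)
      (fun v => (hlt v).le.trans (le_max_left _ _)) x).trans_lt (max_lt hμ hκ')

theorem Ordinal.type_eq_ord_of_forall_mk_lt {V : Type u} (r : V → V → Prop) [IsWellOrder V r]
    (h : ∀ a, #{b | r b a} < #V) : Ordinal.type r = (#V).ord := by
  apply le_antisymm
  · refine le_of_forall_lt fun o ho => ?_
    obtain ⟨a, rfl⟩ := Ordinal.typein_surj r ho
    rw [Cardinal.lt_ord]
    exact h a
  · rw [Cardinal.ord_le, Ordinal.card_type]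

/-- The colouring number is witnessed by some well-ordering. -/
theorem exists_wellOrder_forall_mk_lt_colNumber {V : Type u} (G : SimpleGraph V) :
    ∃ r : V → V → Prop, IsWellOrder V r ∧
      ∀ v, #{w : V // r w v ∧ G.Adj w v} < colNumber G := by
  refine csInf_mem (s := {μ : Cardinal.{u} | ∃ r : V → V → Prop, IsWellOrder V r ∧
    ∀ v, #{w : V // r w v ∧ G.Adj w v} < μ}) ⟨Order.succ #V, WellOrderingRel, inferInstance, ?_⟩
  exact fun v => Order.lt_succ_of_le (mk_subtype_le _)

/-- Every graph has a good well-ordering of its vertex set of order type `#V`: one in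
which every vertex has strictly fewer than `colNumber G` many edges to earlier
vertices. -/
theorem exists_good_wellOrder {V : Type u} (G : SimpleGraph V) :
    ∃ (r : V → V → Prop) (hwo : IsWellOrder V r),
      @Ordinal.type V r hwo = (#V).ord ∧
      ∀ v, #{w : V // r w v ∧ G.Adj w v} < colNumber G := by
  obtain ⟨r, hr, hgood⟩ := exists_wellOrder_forall_mk_lt_colNumber G
  rcases lt_or_ge #V ℵ₀ with hfin | hinf
  · refine ⟨r, hr, ?_, hgood⟩
    obtain ⟨n, hn⟩ := lt_aleph0.1 hfin
    have h : (Ordinal.type r).card = n := by rw [Ordinal.card_type, hn]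
    rw [hn, ord_natCast, Ordinal.card_eq_nat.1 h]
  obtain ⟨s, hs, hsV⟩ := exists_ord_eq V
  have hsmall (a : V) : #{b | s b a} < #V := by
    have := Ordinal.typein_lt_type s a
    rwa [← hsV, lt_ord] at this
  rcases le_or_gt #V (colNumber G) with hle | hlt
  · refine ⟨s, hs, hsV.symm, fun v => lt_of_le_of_lt ?_ ((hsmall v).trans_le hle)⟩
    exact mk_le_mk_of_subset (s := {w | s w v ∧ G.Adj w v}) fun w hw => hw.1
  let p : V → V → Prop := fun w v => r w v ∧ G.Adj w v
  have hp : WellFounded p := Subrelation.wf (fun h => h.1) hr.wf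
  -- `f v` is the `s`-least vertex of which `v` is an iterated earlier neighbour.
  have hex (v : V) : {x | Relation.ReflTransGen p v x}.Nonempty := ⟨v, .refl⟩
  let f : V → V := fun v => hs.wf.min _ (hex v)
  have hf (v : V) : Relation.ReflTransGen p v (f v) := hs.wf.min_mem _ (hex v)
  have hfle {v x : V} (h : Relation.ReflTransGen p v x) : ¬ s x (f v) :=
    hs.wf.not_lt_min _ h
  let g : V ↪ V × V := ⟨fun v => (f v, v), fun a b h => congrArg Prod.snd h⟩
  let t : V → V → Prop := Order.Preimage g (Prod.Lex s r)
  have ht : IsWellOrder V t := (RelEmbedding.preimage g (Prod.Lex s r)).isWellOrder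
  have ht_iff (w v : V) : t w v ↔ s (f w) (f v) ∨ f w = f v ∧ r w v := Prod.lex_def
  refine ⟨t, ht, Ordinal.type_eq_ord_of_forall_mk_lt t fun a => ?_, fun v => ?_⟩
  · have hS : #(insert (f a) {x | s x (f a)} : Set V) < #V :=
      mk_insert_le.trans_lt
        (add_lt_of_lt hinf (hsmall _) (one_lt_aleph0.trans_le hinf))
    refine (mk_le_mk_of_subset fun w hw => ?_).trans_lt
      (hp.mk_biUnion_reflTransGen_lt hinf hlt hgood hS)
    refine Set.mem_biUnion (x := f w) ?_ (hf w)
    rcases (ht_iff w a).1 hw with h | h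
    · exact Or.inr h
    · exact Or.inl h.1
  · refine (mk_le_mk_of_subset (s := {w | t w v ∧ G.Adj w v}) (t := {w | p w v})
      fun w hw => ⟨?_, hw.2⟩).trans_lt (hgood v)
    rcases trichotomous_of r w v with h | rfl | h
    · exact h
    · exact absurd hw.2 G.irrefl
    · have hvw : ¬ s (f w) (f v) := hfle ((hf w).head ⟨h, hw.2.symm⟩)
      rcases (ht_iff w v).1 hw.1 with h' | h'
      · exact absurd h' hvw
      · exact h'.2
end

section
/- The complete graph on ℵ₁ vertices admits both an ℵ₀-decomposition and an ℵ₁-decomposition; that is, its edge set can be partitioned into ℵ₀ many spanning trees, and it can also be partitioned into ℵ₁ many spanning trees. -/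
universe u
open Cardinal

/-- A family `p` of parent functions on `V` indexed by `ι`, each defining a rooted tree,
such that any two distinct vertices are joined by an edge of exactly one of the trees. -/
def HasParentDecomposition (V ι : Type*) : Prop :=
  ∃ p : ι → V → V, (∀ i, ∃ r, p i r = r ∧ ∀ v, ∃ k, (p i)^[k] v = r) ∧
    ∀ a b, a ≠ b → ∃! i, p i a = b ∨ p i b = a

theorem isTree_fromRel_of_iterate_eq {V : Type*} (p : V → V) (r : V) (hr : p r = r)
    (h : ∀ v, ∃ k, p^[k] v = r) : (SimpleGraph.fromRel fun a b => p a = b).IsTree := by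
  have hreach : ∀ k v, p^[k] v = r →
      (SimpleGraph.fromRel fun a b => p a = b).Reachable v r := by
    intro k
    induction k with
    | zero => rintro v rfl; exact .rfl
    | succ k ih =>
      intro v hv
      refine SimpleGraph.Reachable.trans ?_ (ih (p v) hv)
      by_cases hvp : v = p v
      · rw [← hvp]
      · exact SimpleGraph.Adj.reachable ⟨hvp, .inl rfl⟩
  have hbridge : ∀ v, v ≠ p v →
      ¬ ((SimpleGraph.fromRel fun a b => p a = b).deleteEdges {s(v, p v)}).Reachable v (p v) := by
    intro v hv
    have hclosed : ∀ u w, ((SimpleGraph.fromRel fun a b => p a = b).deleteEdges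
        {s(v, p v)}).Reachable u w → (∃ k, p^[k] u = v) → ∃ k, p^[k] w = v := by
      rintro u w ⟨q⟩
      induction q with
      | nil => exact id
      | cons hadj _ ih =>
        rintro ⟨k, hk⟩
        apply ih
        rw [SimpleGraph.deleteEdges_adj, SimpleGraph.fromRel_adj] at hadj
        obtain ⟨⟨-, rfl | rfl⟩, hne⟩ := hadj
        · cases k with
          | zero => subst hk; exact absurd rfl hne
          | succ k => exact ⟨k, hk⟩
        · exact ⟨k + 1, hk⟩
    intro hre
    obtain ⟨k, hk⟩ := hclosed _ _ hre ⟨0, rfl⟩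
    obtain ⟨m, hm⟩ := h v
    have hper : Function.IsPeriodicPt p (k + 1) v := hk
    have h1 : p^[m * (k + 1)] v = v := hper.const_mul m
    have h2 : p^[m * (k + 1)] v = r := by
      rw [show m * (k + 1) = m * k + m by ring, Function.iterate_add_apply, hm,
        Function.iterate_fixed hr]
    rw [← h1, h2] at hv
    exact hv hr.symm
  refine ⟨?_, ?_⟩
  · have : Nonempty V := ⟨r⟩
    refine ⟨fun u v => ?_⟩
    obtain ⟨k, hk⟩ := h u
    obtain ⟨l, hl⟩ := h v
    exact (hreach k u hk).trans (hreach l v hl).symm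
  · rw [SimpleGraph.isAcyclic_iff_forall_adj_isBridge]
    rintro v w ⟨hne, rfl | rfl⟩
    · exact hbridge v hne
    · rw [Sym2.eq_swap]
      exact hbridge w hne.symm

theorem HasParentDecomposition.hasDecomposition {V ι : Type u}
    (h : HasParentDecomposition V ι) : HasDecomposition (⊤ : SimpleGraph V) #ι := by
  obtain ⟨p, hp, hu⟩ := h
  refine ⟨ι, fun i => SimpleGraph.fromRel fun a b => p i a = b, rfl, fun i => ⟨le_top, ?_⟩, ?_, ?_⟩
  · obtain ⟨r, hr, h⟩ := hp i
    exact isTree_fromRel_of_iterate_eq (p i) r hr h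
  · intro i j hij
    rw [Set.disjoint_left]
    intro e
    induction e with
    | h a b =>
      rintro ⟨hne, hi⟩ ⟨-, hj⟩
      exact hij ((hu a b hne).unique hi hj)
  · ext e
    induction e with
    | h a b =>
      simp only [Set.mem_iUnion, SimpleGraph.mem_edgeSet, SimpleGraph.fromRel_adj,
        SimpleGraph.top_adj]
      exact ⟨fun ⟨_, hne, _⟩ => hne, fun hne => (hu a b hne).exists.imp fun i hi => ⟨hne, hi⟩⟩

theorem HasParentDecomposition.congr {V W ι κ : Type*} (e : V ≃ W) (f : ι ≃ κ)
    (h : HasParentDecomposition W κ) : HasParentDecomposition V ι := by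
  obtain ⟨p, hp, hu⟩ := h
  refine ⟨fun i v => e.symm (p (f i) (e v)), fun i => ?_, fun a b hab => ?_⟩
  · obtain ⟨r, hr, h⟩ := hp (f i)
    refine ⟨e.symm r, by simp [hr], fun v => ?_⟩
    obtain ⟨k, hk⟩ := h (e v)
    have hs : Function.Semiconj e.symm (p (f i)) fun v => e.symm (p (f i) (e v)) :=
      fun x => by simp
    refine ⟨k, ?_⟩
    rw [← hk, hs.iterate_right k, e.symm_apply_apply]
  · obtain ⟨i, hi, hi'⟩ := hu (e a) (e b) (e.injective.ne hab)
    simp only [Equiv.symm_apply_eq]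
    refine ⟨f.symm i, by simpa using hi, fun j hj => ?_⟩
    rw [Equiv.eq_symm_apply]
    exact hi' _ hj

/-- The tree with index `i` is the double star with centres `(i, false)` and `(i, true)`. -/
theorem hasParentDecomposition_prod_bool (I : Type*) [LinearOrder I] :
    HasParentDecomposition (I × Bool) I := by
  refine ⟨fun i x => if x.1 = i then (i, false) else (i, if i < x.1 then x.2 else !x.2),
    fun i => ⟨(i, false), by simp, fun v => ⟨2, ?_⟩⟩, ?_⟩
  · by_cases hv : v.1 = i <;> simp [hv]
  · have key : ∀ j l : I, ∀ c d : Bool, j < l → ∃! i,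
        (if j = i then (i, false) else (i, if i < j then c else !c)) = (l, d) ∨
        (if l = i then (i, false) else (i, if i < l then d else !d)) = (j, c) := by
      intro j l c d hjl
      by_cases hcd : c = d
      · refine ⟨j, ?_, ?_⟩
        · simp [hjl.ne', hjl, hcd]
        · intro i hi
          by_contra hij
          simp only [Ne.symm hij, if_false, Prod.mk.injEq] at hi
          rcases hi with ⟨rfl, hi⟩ | hi
          · simp [hjl.not_gt, hcd] at hi
          · split_ifs at hi <;> simp_all
      · refine ⟨l, ?_, ?_⟩
        · left
          simp only [hjl.ne, if_false, hjl.not_gt]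
          cases c <;> cases d <;> simp_all
        · intro i hi
          by_contra hil
          simp only [Ne.symm hil, if_false, Prod.mk.injEq] at hi
          rcases hi with hi | ⟨rfl, hi⟩
          · split_ifs at hi <;> simp_all
          · simp [hjl] at hi
            exact hcd hi.symm
    rintro ⟨j, c⟩ ⟨l, d⟩ hne
    rcases lt_trichotomy j l with h | rfl | h
    · exact key j l c d h
    · have hcd : c ≠ d := fun h => hne (by rw [h])
      refine ⟨j, ?_, fun i hi => ?_⟩
      · cases c <;> cases d <;> simp_all
      · by_contra hij
        simp [Ne.symm hij, hij] at hi
    · obtain ⟨i, hi, hi'⟩ := key l j d c h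
      exact ⟨i, hi.symm, fun k hk => hi' k hk.symm⟩

/-- A decomposition of a complete graph extends to a well-ordered set of new vertices, provided
every new vertex has as many predecessors as there are trees. -/
theorem HasParentDecomposition.sum {B W ι : Type*} [LinearOrder W] [WellFoundedLT W]
    (h : HasParentDecomposition B ι) (f : W → ι → B ⊕ W)
    (hf : ∀ w, Function.Injective (f w))
    (hrange : ∀ w, Set.range (f w) = Set.range Sum.inl ∪ Sum.inr '' Set.Iio w) :
    HasParentDecomposition (B ⊕ W) ι := by
  obtain ⟨q, hq, hu⟩ := h
  have hinl : ∀ w b, ∃ i, f w i = .inl b := fun w b => by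
    have : Sum.inl b ∈ Set.range (f w) := by simp [hrange]
    exact this
  have hinr : ∀ w w', (∃ i, f w i = .inr w') ↔ w' < w := fun w w' => by
    change Sum.inr w' ∈ Set.range (f w) ↔ _
    simp [hrange]
  refine ⟨fun i => Sum.elim (fun b => .inl (q i b)) (fun w => f w i), fun i => ?_, ?_⟩
  · obtain ⟨r, hr, hk⟩ := hq i
    refine ⟨.inl r, by simp [hr], ?_⟩
    have hB : ∀ b, ∃ k, (Sum.elim (fun b => .inl (q i b)) (fun w => f w i) :
        B ⊕ W → B ⊕ W)^[k] (.inl b) = .inl r := fun b => by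
      obtain ⟨k, hk⟩ := hk b
      have hs : Function.Semiconj (Sum.inl : B → B ⊕ W) (q i)
        (Sum.elim (fun b => .inl (q i b)) (fun w => f w i)) := fun x => rfl
      exact ⟨k, by rw [← hk, hs.iterate_right k]⟩
    rintro (b | w)
    · exact hB b
    · induction w using WellFoundedLT.induction with
      | ind w ih =>
        have hstep : ∃ k, (Sum.elim (fun b => .inl (q i b)) (fun w => f w i) :
            B ⊕ W → B ⊕ W)^[k] (f w i) = .inl r := by
          rcases hx : f w i with b | w'
          · exact hB b
          · exact ih w' ((hinr w w').1 ⟨i, hx⟩)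
        obtain ⟨k, hk⟩ := hstep
        exact ⟨k + 1, hk⟩
  · have hlt : ∀ w w', w' < w → ∃! i, f w i = .inr w' ∨ f w' i = .inr w := fun w w' hw => by
      obtain ⟨i, hi⟩ := (hinr w w').2 hw
      refine ⟨i, .inl hi, ?_⟩
      rintro j (hj | hj)
      · exact hf w (hj.trans hi.symm)
      · exact absurd ((hinr w' w).1 ⟨j, hj⟩) hw.not_gt
    rintro (a | w) (b | w') hne
    · simpa using hu a b (fun h => hne (by rw [h]))
    · obtain ⟨i, hi⟩ := hinl w' a
      refine ⟨i, .inr hi, ?_⟩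
      rintro j (hj | hj)
      · simp at hj
      · exact hf w' (hj.trans hi.symm)
    · obtain ⟨i, hi⟩ := hinl w b
      refine ⟨i, .inl hi, ?_⟩
      rintro j (hj | hj)
      · exact hf w (hj.trans hi.symm)
      · simp at hj
    · rcases lt_trichotomy w w' with h | rfl | h
      · obtain ⟨i, hi, hi'⟩ := hlt w' w h
        exact ⟨i, hi.symm, fun j hj => hi' j hj.symm⟩
      · exact absurd rfl hne
      · exact hlt w w' h

theorem hasParentDecomposition_sum_nat (W : Type*) [LinearOrder W] [WellFoundedLT W]
    (hW : ∀ w : W, (Set.Iio w).Countable) :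
    HasParentDecomposition ((ℕ × Bool) ⊕ W) ℕ := by
  have hex : ∀ w : W, ∃ f : ℕ → (ℕ × Bool) ⊕ W, Function.Injective f ∧
      Set.range f = Set.range Sum.inl ∪ Sum.inr '' Set.Iio w := fun w => by
    have hc : (Set.range Sum.inl ∪ Sum.inr '' Set.Iio w : Set ((ℕ × Bool) ⊕ W)).Countable :=
      (Set.countable_range _).union ((hW w).image _)
    have hi : (Set.range Sum.inl ∪ Sum.inr '' Set.Iio w : Set ((ℕ × Bool) ⊕ W)).Infinite :=
      (Set.infinite_range_of_injective Sum.inl_injective).mono Set.subset_union_left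
    have := hc.to_subtype
    have := hi.to_subtype
    obtain ⟨e⟩ := nonempty_equiv_of_countable (α := ℕ)
      (β := (Set.range Sum.inl ∪ Sum.inr '' Set.Iio w : Set ((ℕ × Bool) ⊕ W)))
    refine ⟨fun n => e n, Subtype.val_injective.comp e.injective, ?_⟩
    rw [show (fun n => (e n : (ℕ × Bool) ⊕ W)) = Subtype.val ∘ e from rfl, e.surjective.range_comp,
      Subtype.range_coe]
  choose f hf hrange using hex
  exact (hasParentDecomposition_prod_bool ℕ).sum f hf hrange

/-- The complete graph on ℵ₁ vertices admits both an ℵ₀-decomposition and an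
ℵ₁-decomposition. -/
theorem completeGraph_aleph_one_decompositions (V : Type u) (hV : #V = aleph 1) :
    HasDecomposition (⊤ : SimpleGraph V) aleph0 ∧
    HasDecomposition (⊤ : SimpleGraph V) (aleph 1) := by
  obtain ⟨_, _, hord⟩ := exists_ord_eq_type_lt V
  have hW : ∀ w : V, (Set.Iio w).Countable := fun w => by
    rw [← le_aleph0_iff_set_countable, ← lt_aleph_one_iff, ← hV]
    exact mk_Iio_lt w hord
  constructor
  · have e : Nonempty (V ≃ (ℕ × Bool) ⊕ V) := by
      rw [← Cardinal.lift_mk_eq']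
      simp [hV, add_eq_right (aleph0_le_aleph 1) (aleph0_le_aleph 1)]
    have h := ((hasParentDecomposition_sum_nat V hW).congr e.some
      (Equiv.ulift.{u} (α := ℕ))).hasDecomposition
    simpa using h
  · have e : Nonempty (V ≃ V × Bool) := by
      rw [← Cardinal.lift_mk_eq']
      have h2 : (2 : Cardinal.{u}) ≤ aleph 1 := ofNat_le_aleph0.trans (aleph0_le_aleph 1)
      simp [hV, mul_eq_left (aleph0_le_aleph 1) h2]
    have h := ((hasParentDecomposition_prod_bool V).congr e.some (Equiv.refl V)).hasDecomposition
    rwa [hV] at h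
end

section
/- Let k be a positive natural number and let G be a graph (finite or infinite) that admits a k-covering. Then the colouring number of G is at most 2k; that is, there exists a well-ordering <* of the vertex set of G such that every vertex v has strictly fewer than 2k edges joining it to vertices preceding v in <*. -/
universe u
open Cardinal

/-- A `k`-covering of `G`: a family of `k` spanning trees whose edge sets cover the
edge set of `G`. -/
def HasCoveringN {V : Type u} (G : SimpleGraph V) (k : ℕ) : Prop :=
  ∃ T : Fin k → SimpleGraph V,
    (∀ i, IsSpanningTree G (T i)) ∧
    (⋃ i, (T i).edgeSet) = G.edgeSet

/-- The number of neighbours of `v` in the finite set `D`. -/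
noncomputable def degreeIn {V : Type u} (G : SimpleGraph V) (D : Finset V) (v : V) : ℕ :=
  open Classical in (D.filter (G.Adj v)).card

/-- Twice the number of edges with at least one end in `C` and both ends in `C ∪ D`,
for disjoint `C` and `D`. -/
noncomputable def edgeWeight {V : Type u} (G : SimpleGraph V) (D C : Finset V) : ℕ :=
  ∑ v ∈ C, (degreeIn G C v + 2 * degreeIn G D v)

/-- Every finite set `C` outside `S` meets at most `k * C.card` edges of `G[S ∪ C]`. -/
def IsSaturated {V : Type u} (G : SimpleGraph V) (k : ℕ) (S : Set V) : Prop :=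
  ∀ C D : Finset V, Disjoint (C : Set V) S → (D : Set V) ⊆ S →
    edgeWeight G D C ≤ 2 * k * C.card

lemma degreeIn_mono {V : Type u} (G : SimpleGraph V) {D E : Finset V} (h : D ⊆ E) (v : V) :
    degreeIn G D v ≤ degreeIn G E v := by
  classical
  exact Finset.card_le_card (Finset.filter_subset_filter _ h)

lemma degreeIn_union {V : Type u} [DecidableEq V] (G : SimpleGraph V) {D E : Finset V}
    (h : Disjoint D E) (v : V) :
    degreeIn G (D ∪ E) v = degreeIn G D v + degreeIn G E v := by
  classical
  unfold degreeIn
  rw [Finset.filter_union, Finset.card_union_of_disjoint]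
  exact Finset.disjoint_filter_filter h

lemma sum_degreeIn_comm {V : Type u} (G : SimpleGraph V) (C D : Finset V) :
    ∑ v ∈ C, degreeIn G D v = ∑ v ∈ D, degreeIn G C v := by
  classical
  have h := Finset.sum_card_bipartiteAbove_eq_sum_card_bipartiteBelow (s := C) (t := D) G.Adj
  simpa only [degreeIn, Finset.bipartiteAbove, Finset.bipartiteBelow, G.adj_comm] using h

lemma edgeWeight_mono {V : Type u} (G : SimpleGraph V) {D E : Finset V} (h : D ⊆ E)
    (C : Finset V) : edgeWeight G D C ≤ edgeWeight G E C :=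
  Finset.sum_le_sum fun v _ => by
    have := degreeIn_mono G h v
    omega

lemma edgeWeight_union {V : Type u} [DecidableEq V] (G : SimpleGraph V) {B C D : Finset V}
    (hBC : Disjoint B C) (hDB : Disjoint D B) :
    edgeWeight G D (B ∪ C) = edgeWeight G D B + edgeWeight G (D ∪ B) C := by
  have h := sum_degreeIn_comm G B C
  simp only [edgeWeight, Finset.sum_union hBC, degreeIn_union G hBC, degreeIn_union G hDB,
    Finset.sum_add_distrib, ← Finset.mul_sum, mul_add]
  omega

/-- The handshake bound for forests. -/
lemma SimpleGraph.IsAcyclic.sum_degreeIn_lt {V : Type u} {T : SimpleGraph V} (hT : T.IsAcyclic)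
    {C : Finset V} (hC : C.Nonempty) : ∑ v ∈ C, degreeIn T C v < 2 * C.card := by
  classical
  have : Nonempty C := hC.to_subtype
  obtain ⟨F, hTF, -, hF⟩ := (SimpleGraph.connected_top (V := C)).exists_isTree_le_of_le_of_isAcyclic
    le_top (SimpleGraph.IsAcyclic.comap (G := T.comap ((↑) : C → V)) ⟨(↑), fun h => h⟩
      Subtype.val_injective hT)
  have hdeg : ∀ v : C, degreeIn T C v ≤ F.degree v := by
    intro v
    rw [degreeIn, ← SimpleGraph.card_neighborFinset_eq_degree,
      ← Finset.card_map (Function.Embedding.subtype (· ∈ C))]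
    refine Finset.card_le_card fun w hw => ?_
    obtain ⟨hwC, hvw⟩ := Finset.mem_filter.1 hw
    have : F.Adj v ⟨w, hwC⟩ := hTF hvw
    simpa [hwC] using this
  have hsum := F.sum_degrees_eq_twice_card_edges
  have hcard := hF.card_edgeFinset
  have hle := Finset.sum_le_sum fun v (_ : v ∈ Finset.univ) => hdeg v
  rw [← Finset.sum_coe_sort C (fun v => degreeIn T C v)]
  rw [Fintype.card_coe] at hcard
  omega

lemma HasCoveringN.sum_degreeIn_lt {V : Type u} {G : SimpleGraph V} {k : ℕ} (hk : 0 < k)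
    (h : HasCoveringN G k) {C : Finset V} (hC : C.Nonempty) :
    ∑ v ∈ C, degreeIn G C v < 2 * k * C.card := by
  classical
  obtain ⟨T, hT, hcov⟩ := h
  have hdeg : ∀ v, degreeIn G C v ≤ ∑ i, degreeIn (T i) C v := by
    intro v
    refine (Finset.card_le_card fun w hw => ?_).trans Finset.card_biUnion_le
    obtain ⟨hwC, hvw⟩ := Finset.mem_filter.1 hw
    have he : s(v, w) ∈ ⋃ i, (T i).edgeSet := hcov ▸ hvw
    obtain ⟨i, hi⟩ := Set.mem_iUnion.1 he
    exact Finset.mem_biUnion.2 ⟨i, Finset.mem_univ i, Finset.mem_filter.2 ⟨hwC, hi⟩⟩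
  have : Nonempty (Fin k) := ⟨⟨0, hk⟩⟩
  calc ∑ v ∈ C, degreeIn G C v ≤ ∑ v ∈ C, ∑ i, degreeIn (T i) C v :=
        Finset.sum_le_sum fun v _ => hdeg v
    _ = ∑ i, ∑ v ∈ C, degreeIn (T i) C v := Finset.sum_comm
    _ < ∑ _i : Fin k, 2 * C.card :=
        Finset.sum_lt_sum_of_nonempty Finset.univ_nonempty fun i _ =>
          (hT i).2.isAcyclic.sum_degreeIn_lt hC
    _ = 2 * k * C.card := by
        simp only [Finset.sum_const, Finset.card_univ, Fintype.card_fin, smul_eq_mul]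
        ring

lemma isSaturated_empty {V : Type u} {G : SimpleGraph V} {k : ℕ}
    (hG : ∀ C : Finset V, C.Nonempty → ∑ v ∈ C, degreeIn G C v < 2 * k * C.card) :
    IsSaturated G k ∅ := by
  intro C D _ hD
  obtain rfl : D = ∅ := by simpa using hD
  rcases C.eq_empty_or_nonempty with rfl | hC
  · simp [edgeWeight]
  · simpa [edgeWeight, degreeIn] using (hG C hC).le

lemma IsSaturated.iUnion {V : Type u} {G : SimpleGraph V} {k : ℕ} {ι : Type*} [Nonempty ι]
    {F : ι → Set V} (hF : ∀ i, IsSaturated G k (F i)) (hdir : Directed (· ⊆ ·) F) :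
    IsSaturated G k (⋃ i, F i) := by
  intro C D hC hD
  obtain ⟨i, hi⟩ := hdir.exists_mem_subset_of_finset_subset_biUnion hD
  exact hF i C D (hC.mono_right (Set.subset_iUnion F i)) hi

/-- A saturated set can be enlarged by finitely many vertices to a saturated set containing a
prescribed vertex. -/
lemma IsSaturated.exists_union {V : Type u} {G : SimpleGraph V} {k : ℕ} {S : Set V}
    (hS : IsSaturated G k S) (v : V) :
    ∃ B : Finset V, Disjoint (B : Set V) S ∧ v ∈ S ∪ B ∧ IsSaturated G k (S ∪ B) := by
  classical
  by_cases hv : v ∈ S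
  · exact ⟨∅, by simp, by simp [hv], by simpa using hS⟩
  let P : Set (Finset V × Finset V) :=
    {p | v ∈ p.1 ∧ Disjoint (p.1 : Set V) S ∧ (p.2 : Set V) ⊆ S}
  let f : Finset V × Finset V → ℕ := fun p => 2 * k * p.1.card - edgeWeight G p.2 p.1
  have hP : P.Nonempty := ⟨({v}, ∅), by simp [P, hv]⟩
  obtain ⟨⟨B, D⟩, ⟨hvB, hBS, hDS⟩, hmin⟩ :=
    exists_minimalFor_of_wellFoundedLT (· ∈ P) f hP
  refine ⟨B, hBS, Or.inr hvB, fun C E hC hE => ?_⟩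
  rw [Set.disjoint_union_right] at hC
  have hBC : Disjoint B C := (Finset.disjoint_coe.1 hC.2).symm
  let D' := D ∪ E.filter (· ∈ S)
  have hD'S : (D' : Set V) ⊆ S := by
    intro x hx
    simp only [D', Finset.coe_union, Finset.coe_filter, Set.mem_union, Set.mem_ofPred_eq] at hx
    exact hx.elim (fun h => hDS h) (fun h => h.2)
  have hD'B : Disjoint D' B :=
    Finset.disjoint_coe.1 (hBS.symm.mono_left hD'S)
  have hBCS : Disjoint ((B ∪ C : Finset V) : Set V) S := by
    rw [Finset.coe_union, Set.disjoint_union_left]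
    exact ⟨hBS, hC.1⟩
  have hle : f (B, D) ≤ f (B ∪ C, D') :=
    (le_total _ _).elim id
      (hmin (j := (B ∪ C, D')) ⟨Finset.mem_union_left _ hvB, hBCS, hD'S⟩)
  have hE' : E ⊆ D' ∪ B := by
    intro x hx
    have := hE hx
    simp only [Set.mem_union, Finset.mem_coe] at this
    simp only [D', Finset.mem_union, Finset.mem_filter]
    tauto
  have h₁ := edgeWeight_mono G hE' C
  have h₂ : edgeWeight G D B ≤ edgeWeight G D' B := edgeWeight_mono G Finset.subset_union_left B
  have h₃ := edgeWeight_union G hBC hD'B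
  have h₄ := hS (B ∪ C) D' hBCS hD'S
  have h₅ := hS B D hBS hDS
  simp only [f] at hle
  rw [Finset.card_union_of_disjoint hBC, mul_add] at hle h₄
  omega

/-- In a nonempty finite set outside a saturated set, some vertex has few neighbours. -/
lemma IsSaturated.exists_degreeIn_lt {V : Type u} {G : SimpleGraph V} {k : ℕ}
    (hG : ∀ C : Finset V, C.Nonempty → ∑ v ∈ C, degreeIn G C v < 2 * k * C.card)
    {S : Set V} (hS : IsSaturated G k S) {C : Finset V} (hC : C.Nonempty)
    (hCS : Disjoint (C : Set V) S) :
    ∃ w ∈ C, ∀ D : Finset V, (D : Set V) ⊆ S → degreeIn G D w + degreeIn G C w < 2 * k := by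
  classical
  by_contra! h
  choose! D hDS hD using h
  have hU : ((C.biUnion D : Finset V) : Set V) ⊆ S := by
    simpa using hDS
  have h₁ := hS C (C.biUnion D) hCS hU
  have h₂ := hG C hC
  have h₃ : ∑ _v ∈ C, 2 * k ≤ ∑ v ∈ C, (degreeIn G (C.biUnion D) v + degreeIn G C v) :=
    Finset.sum_le_sum fun v hv => (hD v hv).trans
      (Nat.add_le_add_right (degreeIn_mono G (Finset.subset_biUnion_of_mem D hv) v) _)
  rw [Finset.sum_const, smul_eq_mul, Finset.sum_add_distrib, mul_comm] at h₃
  rw [edgeWeight, Finset.sum_add_distrib, ← Finset.mul_sum] at h₁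
  omega

lemma IsSaturated.exists_ordering {V : Type u} {G : SimpleGraph V} {k : ℕ}
    (hG : ∀ C : Finset V, C.Nonempty → ∑ v ∈ C, degreeIn G C v < 2 * k * C.card)
    {S : Set V} (hS : IsSaturated G k S) (B : Finset V) (hBS : Disjoint (B : Set V) S) :
    ∃ l : V → ℕ, Set.InjOn l B ∧ (∀ x ∈ B, l x < B.card) ∧ ∀ w ∈ B, ∀ D : Finset V,
      (D : Set V) ⊆ S → degreeIn G D w + degreeIn G (B.filter (l · < l w)) w < 2 * k := by
  classical
  induction B using Finset.strongInduction with
  | H B ih =>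
    rcases B.eq_empty_or_nonempty with rfl | hB
    · exact ⟨fun _ => 0, by simp⟩
    obtain ⟨w, hwB, hw⟩ := hS.exists_degreeIn_lt hG hB hBS
    obtain ⟨l, hinj, hlt, hl⟩ := ih (B.erase w) (Finset.erase_ssubset hwB)
      (hBS.mono_left (by exact_mod_cast Finset.erase_subset w B))
    have hcard := Finset.card_erase_add_one hwB
    have hne : ∀ x ∈ B, x ≠ w → l x < (B.erase w).card := fun x hx hxw =>
      hlt x (Finset.mem_erase.2 ⟨hxw, hx⟩)
    refine ⟨Function.update l w (B.erase w).card, ?_, ?_, ?_⟩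
    · intro x hx y hy hxy
      rw [Finset.mem_coe] at hx hy
      by_cases hxw : x = w <;> by_cases hyw : y = w
      · rw [hxw, hyw]
      · subst hxw
        rw [Function.update_self, Function.update_of_ne hyw] at hxy
        have := hne y hy hyw
        omega
      · subst hyw
        rw [Function.update_self, Function.update_of_ne hxw] at hxy
        have := hne x hx hxw
        omega
      · rw [Function.update_of_ne hxw, Function.update_of_ne hyw] at hxy
        exact hinj (by simp [hx, hxw]) (by simp [hy, hyw]) hxy
    · intro x hx
      by_cases hxw : x = w
      · subst hxw
        rw [Function.update_self]
        omega
      · rw [Function.update_of_ne hxw]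
        have := hne x hx hxw
        omega
    · intro x hx D hD
      by_cases hxw : x = w
      · subst hxw
        exact (Nat.add_le_add_left (degreeIn_mono G (Finset.filter_subset _ _) x) _).trans_lt
          (hw D hD)
      · refine (Nat.add_le_add_left (degreeIn_mono G (fun y hy => ?_) x) _).trans_lt
          (hl x (Finset.mem_erase.2 ⟨hxw, hx⟩) D hD)
        rw [Finset.mem_filter, Function.update_of_ne hxw] at hy
        have := hne x hx hxw
        have hyw : y ≠ w := by
          rintro rfl
          rw [Function.update_self] at hy
          omega
        rw [Function.update_of_ne hyw] at hy
        exact Finset.mem_filter.2 ⟨Finset.mem_erase.2 ⟨hyw, hy.1⟩, hy.2⟩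

lemma exists_transfinite_union {α : Type*} [LinearOrder α] [WellFoundedLT α]
    (next : Set α → α → Set α) :
    ∃ F : α → Set α, ∀ a, F a = (⋃ b : Set.Iio a, F b) ∪ next (⋃ b : Set.Iio a, F b) a := by
  let step : ∀ a : α, (∀ b, b < a → Set α) → Set α := fun a ih =>
    (⋃ b : Set.Iio a, ih b b.2) ∪ next (⋃ b : Set.Iio a, ih b b.2) a
  exact ⟨wellFounded_lt.fix step, fun a => wellFounded_lt.fix_eq step a⟩

/-- Erdős–Hajnal: if `G` admits a `k`-covering for a positive natural number `k`,
then the colouring number of `G` is at most `2 * k`: there is a well-ordering of the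
vertex set in which every vertex has strictly fewer than `2 * k` edges to earlier
vertices. -/
theorem col_le_of_coveringN {V : Type u} (G : SimpleGraph V) (k : ℕ) (hk : 0 < k)
    (h : HasCoveringN G k) :
    ∃ r : V → V → Prop, IsWellOrder V r ∧
      ∀ v, #{w : V // r w v ∧ G.Adj w v} < ((2 * k : ℕ) : Cardinal.{u}) := by
  classical
  have hG := fun C hC => h.sum_degreeIn_lt hk (C := C) hC
  obtain ⟨_, _⟩ := exists_wellFoundedLT V
  have hnext : ∀ (S : Set V) (v : V), ∃ B : Finset V, IsSaturated G k S →
      Disjoint (B : Set V) S ∧ v ∈ S ∪ B ∧ IsSaturated G k (S ∪ B) := by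
    intro S v
    by_cases hS : IsSaturated G k S
    · obtain ⟨B, hB⟩ := hS.exists_union v
      exact ⟨B, fun _ => hB⟩
    · exact ⟨∅, fun h => absurd h hS⟩
  choose next hnext using hnext
  obtain ⟨F, hF⟩ := exists_transfinite_union fun S v => (next S v : Set V)
  let S : V → Set V := fun v => ⋃ u : Set.Iio v, F u
  have hFS : ∀ v, F v = S v ∪ next (S v) v := hF
  have hmem : ∀ {u v}, u < v → F u ⊆ S v := fun {u v} huv =>
    Set.subset_iUnion (fun u : Set.Iio v => F u) ⟨u, huv⟩
  have hmono : Monotone F := by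
    intro u v huv
    rcases huv.eq_or_lt with rfl | huv
    · exact subset_rfl
    · rw [hFS v]
      exact (hmem huv).trans Set.subset_union_left
  have hS : ∀ v, IsSaturated G k (S v) := by
    intro v
    induction v using WellFoundedLT.induction with
    | ind v ih =>
      rcases isEmpty_or_nonempty (Set.Iio v) with hv | hv
      · simp only [S, Set.iUnion_of_empty]
        exact isSaturated_empty hG
      · have hmono' : Monotone fun u : Set.Iio v => F u := fun _ _ huw => hmono huw
        refine IsSaturated.iUnion (fun u => ?_) hmono'.directed_le
        rw [hFS u]
        exact (hnext _ _ (ih u u.2)).2.2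
  choose l hinj _ hl using fun v =>
    (hS v).exists_ordering hG (next (S v) v) (hnext _ v (hS v)).1
  have hself : ∀ w, {v | w ∈ F v}.Nonempty := fun w =>
    ⟨w, by rw [Set.mem_ofPred_eq, hFS w]; exact (hnext _ w (hS w)).2.1⟩
  let rank : V → V := fun w => wellFounded_lt.min {v | w ∈ F v} (hself w)
  have hrank : ∀ w, w ∈ F (rank w) := fun w => wellFounded_lt.min_mem _ (hself w)
  have hpiece : ∀ w, w ∈ next (S (rank w)) (rank w) := by
    intro w
    have hw := hrank w
    rw [hFS] at hw
    refine hw.resolve_left fun hw => ?_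
    obtain ⟨u, hu⟩ := Set.mem_iUnion.1 hw
    exact wellFounded_lt.not_lt_min {v | w ∈ F v} hu u.2
  let key : V → V ×ₗ ℕ := fun w => toLex (rank w, l (rank w) w)
  have hkey : Function.Injective key := by
    intro x y hxy
    obtain ⟨h₁, h₂⟩ := Prod.ext_iff.1 (toLex.injective hxy)
    simp only at h₁ h₂
    rw [← h₁] at h₂
    exact hinj (rank x) (hpiece x) (by rw [h₁]; exact hpiece y) h₂
  refine ⟨fun x y => key x < key y,
    (RelEmbedding.preimage ⟨key, hkey⟩ (· < ·)).isWellOrder, fun v => ?_⟩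
  by_contra! hcard
  obtain ⟨s, hs⟩ := Cardinal.exists_finset_eq_card hcard
  let t : Finset V := s.map (Function.Embedding.subtype _)
  have ht : ∀ w ∈ t, key w < key v ∧ G.Adj w v := by
    intro w hw
    obtain ⟨x, -, rfl⟩ := Finset.mem_map.1 hw
    exact x.2
  have hD : ((t.filter (rank · < rank v) : Finset V) : Set V) ⊆ S (rank v) := by
    intro w hw
    exact hmem (Finset.mem_filter.1 hw).2 (hrank w)
  have hlt := hl (rank v) v (hpiece v) _ hD
  have hle : t.card ≤ degreeIn G (t.filter (rank · < rank v)) v +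
      degreeIn G ((next (S (rank v)) (rank v)).filter (l (rank v) · < l (rank v) v)) v := by
    refine (Finset.card_le_card fun w hw => ?_).trans (Finset.card_union_le _ _)
    obtain ⟨hwv, hadj⟩ := ht w hw
    rcases Prod.Lex.toLex_lt_toLex.1 hwv with hr | ⟨hr, hll⟩
    · exact Finset.mem_union_left _ (by simp [hw, hr, hadj.symm])
    · simp only at hr hll
      have hwp := hpiece w
      rw [hr] at hll hwp
      exact Finset.mem_union_right _ (by simp [hwp, hll, hadj.symm])
  rw [Finset.card_map, ← hs] at hle
  omega
end

section
/- For every natural number k ≥ 1, every graph that admits a k-covering and a (2k−1)-packing admits a (2k−1)-decomposition. -/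
universe u
open Cardinal

/-- A `k`-packing of `G`: a family of `k` pairwise edge-disjoint spanning trees. -/
def HasPackingN {V : Type u} (G : SimpleGraph V) (k : ℕ) : Prop :=
  ∃ T : Fin k → SimpleGraph V,
    (∀ i, IsSpanningTree G (T i)) ∧
    Pairwise (fun i j => Disjoint (T i).edgeSet (T j).edgeSet)

/-- A `k`-decomposition of `G`: a family of `k` spanning trees whose edge sets
partition the edge set of `G`. -/
def HasDecompositionN {V : Type u} (G : SimpleGraph V) (k : ℕ) : Prop :=
  ∃ T : Fin k → SimpleGraph V,
    (∀ i, IsSpanningTree G (T i)) ∧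
    (Pairwise (fun i j => Disjoint (T i).edgeSet (T j).edgeSet)) ∧
    (⋃ i, (T i).edgeSet) = G.edgeSet

/-! ### Counting adjacent pairs -/

open Classical in
/-- The number of pairs in `A × B` that are adjacent in `G`. -/
noncomputable def adjCount {V : Type u} (G : SimpleGraph V) (A B : Finset V) : ℕ :=
  ∑ x ∈ A, ∑ y ∈ B, if G.Adj x y then 1 else 0

lemma adjCount_comm {V : Type u} (G : SimpleGraph V) (A B : Finset V) :
    adjCount G A B = adjCount G B A := by
  unfold adjCount
  rw [Finset.sum_comm]
  exact Finset.sum_congr rfl fun y _ => Finset.sum_congr rfl fun x _ => by rw [G.adj_comm]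

open Classical in
lemma adjCount_union_left {V : Type u} (G : SimpleGraph V) {A A' : Finset V} (B : Finset V)
    (h : Disjoint A A') : adjCount G (A ∪ A') B = adjCount G A B + adjCount G A' B := by
  unfold adjCount
  rw [Finset.sum_union h]

open Classical in
lemma adjCount_union_right {V : Type u} (G : SimpleGraph V) (A : Finset V) {B B' : Finset V}
    (h : Disjoint B B') : adjCount G A (B ∪ B') = adjCount G A B + adjCount G A B' := by
  rw [adjCount_comm, adjCount_union_left G A h, adjCount_comm G B, adjCount_comm G B']

lemma adjCount_mono_right {V : Type u} (G : SimpleGraph V) (A : Finset V) {B B' : Finset V}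
    (h : B ⊆ B') : adjCount G A B ≤ adjCount G A B' :=
  Finset.sum_le_sum fun _ _ => Finset.sum_le_sum_of_subset h

open Classical in
lemma two_mul_card_edgeFinset_eq_adjCount {W : Type u} [Fintype W] (G : SimpleGraph W)
    [Fintype G.edgeSet] : 2 * G.edgeFinset.card = adjCount G Finset.univ Finset.univ := by
  have h := G.two_mul_card_edgeFinset
  rw [Finset.card_filter, ← Finset.univ_product_univ, Finset.sum_product] at h
  rw [adjCount]
  convert h

lemma SimpleGraph.IsAcyclic.adjCount_add_two_le {V : Type u} {T : SimpleGraph V}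
    (hT : T.IsAcyclic) {D : Finset V} (hD : D.Nonempty) :
    adjCount T D D + 2 ≤ 2 * D.card := by
  classical
  have : Nonempty (D : Set V) := hD.coe_sort
  obtain ⟨T', hT', -, hle⟩ := SimpleGraph.Connected.exists_isTree_le_of_le_of_isAcyclic
    (G := (⊤ : SimpleGraph (D : Set V))) (H := T.induce (D : Set V))
    SimpleGraph.connected_top le_top (hT.induce _)
  have h1 := hle.card_edgeFinset
  have h2 : (T.induce (D : Set V)).edgeFinset.card ≤ T'.edgeFinset.card :=
    Finset.card_le_card (SimpleGraph.edgeFinset_mono hT')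
  have h3 : adjCount T D D = 2 * (T.induce (D : Set V)).edgeFinset.card := by
    rw [two_mul_card_edgeFinset_eq_adjCount, adjCount, adjCount]
    rw [← Finset.sum_coe_sort D]
    refine Finset.sum_congr rfl fun x _ => ?_
    rw [← Finset.sum_coe_sort D]
    rfl
  have h4 : Fintype.card (D : Set V) = D.card := by simp
  omega

lemma HasCoveringN.adjCount_add_two_le {V : Type u} {G : SimpleGraph V} {k : ℕ} (hk : 1 ≤ k)
    (h : HasCoveringN G k) {D : Finset V} (hD : D.Nonempty) :
    adjCount G D D + 2 ≤ 2 * k * D.card := by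
  classical
  obtain ⟨T, hT, hU⟩ := h
  have h1 : adjCount G D D ≤ ∑ j, adjCount (T j) D D := by
    unfold adjCount
    rw [Finset.sum_comm (s := Finset.univ)]
    refine Finset.sum_le_sum fun x _ => ?_
    rw [Finset.sum_comm]
    refine Finset.sum_le_sum fun y _ => ?_
    split_ifs with hxy
    · have : s(x, y) ∈ ⋃ i, (T i).edgeSet := by rw [hU]; exact hxy
      obtain ⟨i, hi⟩ := Set.mem_iUnion.1 this
      have hi : (T i).Adj x y := hi
      have := Finset.single_le_sum (f := fun j => if (T j).Adj x y then 1 else 0)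
        (fun _ _ => Nat.zero_le _) (Finset.mem_univ i)
      simpa only [if_pos hi] using this
    · exact Nat.zero_le _
  have h2 : ∑ j, (adjCount (T j) D D + 2) ≤ ∑ _j : Fin k, 2 * D.card :=
    Finset.sum_le_sum fun j _ => (hT j).2.isAcyclic.adjCount_add_two_le hD
  simp only [Finset.sum_add_distrib, Finset.sum_const, Finset.card_univ, Fintype.card_fin,
    smul_eq_mul] at h2
  nlinarith

/-! ### Well-orders of small back-degree -/

/-- `A` can be an initial segment of an ordering of back-degree less than `2 * k`: the number of
edges meeting a finite set `D` outside `A` and contained in `A ∪ D` is at most `k * #D`. -/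
def IsClosedFor {V : Type u} (G : SimpleGraph V) (k : ℕ) (A : Set V) : Prop :=
  ∀ D A' : Finset V, Disjoint (D : Set V) A → (A' : Set V) ⊆ A →
    adjCount G D D + 2 * adjCount G D A' ≤ 2 * k * D.card

lemma IsClosedFor.exists_finset {V : Type u} {G : SimpleGraph V} {k : ℕ} {A : Set V}
    (hA : IsClosedFor G k A) (v : V) :
    ∃ A₁ : Set V, A ⊆ A₁ ∧ v ∈ A₁ ∧ (A₁ \ A).Finite ∧ IsClosedFor G k A₁ := by
  classical
  by_cases hv : v ∈ A
  · exact ⟨A, subset_rfl, hv, by simp, hA⟩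
  let P : ℕ → Prop := fun n => ∃ D A' : Finset V, v ∈ D ∧ Disjoint (D : Set V) A ∧
    (A' : Set V) ⊆ A ∧ adjCount G D D + 2 * adjCount G D A' + n = 2 * k * D.card
  have hP : ∃ n, P n := by
    have h := hA {v} ∅ (by simpa using hv) (by simp)
    exact ⟨_, {v}, ∅, by simp, by simpa using hv, by simp, Nat.add_sub_cancel' h⟩
  obtain ⟨D, A', hvD, hDA, hA', hn⟩ := Nat.find_spec hP
  refine ⟨A ∪ D, Set.subset_union_left, Or.inr hvD,
    D.finite_toSet.subset (by simp), ?_⟩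
  intro D₂ A₂ hD₂ hA₂
  rw [Set.disjoint_union_right] at hD₂
  have hDD : Disjoint D D₂ := by
    rw [← Finset.disjoint_coe]; exact hD₂.2.symm
  set A₃ := A₂.filter (· ∈ A) ∪ A' with hA₃
  have hA₃A : (A₃ : Set V) ⊆ A := by
    intro x hx
    simp only [hA₃, Finset.coe_union, Finset.coe_filter, Set.mem_union, Set.mem_ofPred_eq,
      Finset.mem_coe] at hx
    rcases hx with hx | hx
    · exact hx.2
    · exact hA' hx
  have hDA₃ : Disjoint D A₃ := by
    rw [← Finset.disjoint_coe]; exact hDA.mono_right hA₃A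
  have hsub : A₂ ⊆ A₃ ∪ D := by
    intro x hx
    have := hA₂ hx
    simp only [Set.mem_union, Finset.mem_coe] at this
    simp only [hA₃, Finset.mem_union, Finset.mem_filter]
    tauto
  have h1 := adjCount_mono_right G D₂ hsub
  rw [adjCount_union_right G D₂ hDA₃.symm] at h1
  have hdisj : Disjoint ((D ∪ D₂ : Finset V) : Set V) A := by
    rw [Finset.coe_union, Set.disjoint_union_left]; exact ⟨hDA, hD₂.1⟩
  have h2 := hA (D ∪ D₂) A₃ hdisj hA₃A
  have h3 : Nat.find hP ≤ 2 * k * (D ∪ D₂).card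
      - (adjCount G (D ∪ D₂) (D ∪ D₂) + 2 * adjCount G (D ∪ D₂) A₃) :=
    Nat.find_min' hP ⟨D ∪ D₂, A₃, Finset.mem_union_left _ hvD, hdisj, hA₃A,
      Nat.add_sub_cancel' h2⟩
  have h4 : adjCount G D A' ≤ adjCount G D A₃ :=
    adjCount_mono_right G D Finset.subset_union_right
  have h5 := adjCount_comm G D D₂
  have h6 : 2 * k * (D ∪ D₂).card = 2 * k * D.card + 2 * k * D₂.card := by
    rw [Finset.card_union_of_disjoint hDD, mul_add]
  rw [h6, adjCount_union_left G _ hDD,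
    adjCount_union_left G _ hDD, adjCount_union_right G _ hDD, adjCount_union_right G _ hDD]
    at h2 h3
  omega

lemma IsClosedFor.exists_encard_lt {V : Type u} {G : SimpleGraph V} {k : ℕ} (hk : 1 ≤ k)
    (hG : HasCoveringN G k) {A : Set V} (hA : IsClosedFor G k A) {D : Finset V}
    (hD : D.Nonempty) (hDA : Disjoint (D : Set V) A) :
    ∃ x ∈ D, {y | y ∈ A ∪ D ∧ G.Adj x y}.encard < (2 * k : ℕ) := by
  classical
  by_contra! hcon
  have hch : ∀ x, ∃ t : Finset V, x ∈ D →
      (t : Set V) ⊆ {y | y ∈ A ∪ D ∧ G.Adj x y} ∧ t.card = 2 * k := by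
    intro x
    by_cases hx : x ∈ D
    · obtain ⟨t, ht, hc⟩ := Set.exists_subset_encard_eq (hcon x hx)
      have hfin : t.Finite := Set.finite_of_encard_eq_coe hc
      refine ⟨hfin.toFinset, fun _ => ⟨by simpa using ht, ?_⟩⟩
      rw [hfin.encard_eq_coe_toFinset_card] at hc
      exact_mod_cast hc
    · exact ⟨∅, fun h => absurd h hx⟩
  choose t ht using hch
  set A' := (D.biUnion t).filter (· ∈ A) with hA'
  have hA'A : (A' : Set V) ⊆ A := fun x hx => (Finset.mem_filter.1 hx).2
  have hdis : Disjoint A' D := by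
    rw [← Finset.disjoint_coe]; exact (hDA.mono_right hA'A).symm
  have h1 : 2 * k * D.card ≤ adjCount G D (A' ∪ D) := by
    unfold adjCount
    rw [mul_comm, ← smul_eq_mul, ← Finset.sum_const]
    refine Finset.sum_le_sum fun x hx => ?_
    obtain ⟨hsub, hc⟩ := ht x hx
    rw [← hc, ← Finset.card_filter]
    refine Finset.card_le_card fun y hy => ?_
    have hy' := hsub hy
    simp only [Set.mem_ofPred_eq, Set.mem_union, Finset.mem_coe] at hy'
    simp only [hA', Finset.mem_filter, Finset.mem_union, Finset.mem_biUnion]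
    exact ⟨hy'.1.imp (fun h => ⟨⟨x, hx, hy⟩, h⟩) id, hy'.2⟩
  rw [adjCount_union_right G _ hdis] at h1
  have h2 := hA D A' hDA hA'A
  have h3 := hG.adjCount_add_two_le hk hD
  omega

open Classical in
lemma exists_injOn_of_forall_exists_encard_lt {V : Type u} (G : SimpleGraph V) (A : Set V)
    (n : ℕ∞) (D : Finset V)
    (h : ∀ D' ⊆ D, D'.Nonempty → ∃ x ∈ D', {y | y ∈ A ∪ D' ∧ G.Adj x y}.encard < n) :
    ∃ p : V → ℕ, Set.InjOn p D ∧
      ∀ x ∈ D, {y | (y ∈ A ∨ y ∈ D ∧ p y < p x) ∧ G.Adj x y}.encard < n := by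
  induction D using Finset.strongInduction with
  | H D ih =>
  rcases D.eq_empty_or_nonempty with rfl | hD
  · exact ⟨fun _ => 0, by simp, by simp⟩
  obtain ⟨x, hx, hxn⟩ := h D subset_rfl hD
  obtain ⟨p, hp, hpn⟩ := ih (D.erase x) (Finset.erase_ssubset hx)
    fun D' hD' => h D' (hD'.trans (Finset.erase_subset _ _))
  have hlt : ∀ y ∈ D, p y < D.sup p + 1 := fun y hy => Nat.lt_succ_of_le (Finset.le_sup hy)
  refine ⟨Function.update p x (D.sup p + 1), ?_, ?_⟩
  · intro a ha b hb hab
    by_cases hax : a = x <;> by_cases hbx : b = x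
    · rw [hax, hbx]
    · subst hax
      have := hlt b hb
      simp [Function.update_of_ne hbx] at hab
      omega
    · subst hbx
      have := hlt a ha
      simp [Function.update_of_ne hax] at hab
      omega
    · rw [Function.update_of_ne hax, Function.update_of_ne hbx] at hab
      exact hp (by simpa [hax] using ha) (by simpa [hbx] using hb) hab
  · intro a ha
    by_cases hax : a = x
    · subst hax
      refine lt_of_le_of_lt (Set.encard_le_encard ?_) hxn
      rintro y ⟨hy, hay⟩
      exact ⟨hy.imp id fun h => h.1, hay⟩
    · refine lt_of_le_of_lt (Set.encard_le_encard ?_) (hpn a (Finset.mem_erase.2 ⟨hax, ha⟩))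
      rintro y ⟨hy, hay⟩
      refine ⟨hy.imp id fun h => ?_, hay⟩
      rw [Function.update_of_ne hax] at h
      by_cases hyx : y = x
      · subst hyx
        have := hlt a ha
        simp at h
        omega
      · rw [Function.update_of_ne hyx] at h
        exact ⟨Finset.mem_erase.2 ⟨hyx, h.1⟩, h.2⟩

lemma IsClosedFor.iUnion_lt {V : Type u} [LinearOrder V] {G : SimpleGraph V} {k : ℕ}
    (h0 : IsClosedFor G k ∅) {S : V → Set V} (v : V) (hmono : ∀ u w, u ≤ w → w < v → S u ⊆ S w)
    (h : ∀ u < v, IsClosedFor G k (S u)) : IsClosedFor G k (⋃ u : Set.Iio v, S u) := by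
  intro D A' hD hA'
  rcases isEmpty_or_nonempty (Set.Iio v) with hE | hE
  · rw [Set.iUnion_of_empty] at hD hA'
    exact h0 D A' hD hA'
  · have hdir : Directed (· ⊆ ·) fun u : Set.Iio v => S u := by
      refine directed_of_isDirected_le fun a b hab => hmono a b hab b.2
    obtain ⟨u, hu⟩ := hdir.exists_mem_subset_of_finset_subset_biUnion hA'
    exact h u u.2 D A' (hD.mono_right (Set.subset_iUnion (fun u : Set.Iio v => S u) u)) hu

lemma HasCoveringN.exists_isWellOrder {V : Type u} {G : SimpleGraph V} {k : ℕ} (hk : 1 ≤ k)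
    (hG : HasCoveringN G k) :
    ∃ r : V → V → Prop, IsWellOrder V r ∧
      ∀ v, {u | r u v ∧ G.Adj v u}.encard < (2 * k : ℕ) := by
  classical
  obtain ⟨_, _⟩ := exists_wellFoundedLT V
  have h0 : IsClosedFor G k ∅ := by
    intro D A' _ hA'
    have : A' = ∅ := by simpa using hA'
    subst this
    rcases D.eq_empty_or_nonempty with rfl | hD
    · simp [adjCount]
    · have := hG.adjCount_add_two_le hk hD
      simp only [adjCount, Finset.sum_empty, Finset.sum_const_zero] at this ⊢
      omega
  have hext : ∀ (A : Set V) (v : V), ∃ A₁ : Set V, A ⊆ A₁ ∧ v ∈ A₁ ∧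
      (IsClosedFor G k A → (A₁ \ A).Finite ∧ IsClosedFor G k A₁) := by
    intro A v
    by_cases hA : IsClosedFor G k A
    · obtain ⟨A₁, h1, h2, h3⟩ := hA.exists_finset v
      exact ⟨A₁, h1, h2, fun _ => h3⟩
    · exact ⟨Set.univ, Set.subset_univ _, Set.mem_univ _, fun h => absurd h hA⟩
  choose E hE_sub hE_mem hE using hext
  let S : V → Set V := WellFoundedLT.fix fun v ih => E (⋃ u : Set.Iio v, ih u u.2) v
  have hS : ∀ v, S v = E (⋃ u : Set.Iio v, S u) v := fun v => WellFoundedLT.fix_eq _ v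
  have hmono : ∀ u w, u ≤ w → S u ⊆ S w := by
    intro u w huw
    rcases huw.eq_or_lt with rfl | huw
    · rfl
    · rw [hS w]
      exact (Set.subset_iUnion (fun u : Set.Iio w => S u) ⟨u, huw⟩).trans (hE_sub _ _)
  have hclosed : ∀ v, IsClosedFor G k (S v) := by
    intro v
    induction v using WellFoundedLT.induction with
    | ind v ih =>
    rw [hS v]
    exact (hE _ v (h0.iUnion_lt v (fun u w huw _ => hmono u w huw) ih)).2
  have hclosed_lt : ∀ v, IsClosedFor G k (⋃ u : Set.Iio v, S u) := fun v =>
    h0.iUnion_lt v (fun u w huw _ => hmono u w huw) fun u _ => hclosed u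
  have hfin : ∀ v, (S v \ ⋃ u : Set.Iio v, S u).Finite := by
    intro v
    have := (hE _ v (hclosed_lt v)).1
    rwa [← hS v] at this
  have hpos : ∀ v, ∃ p : V → ℕ, Set.InjOn p (hfin v).toFinset ∧ ∀ x ∈ (hfin v).toFinset,
      {y | (y ∈ (⋃ u : Set.Iio v, S u) ∨ y ∈ (hfin v).toFinset ∧ p y < p x) ∧
        G.Adj x y}.encard < (2 * k : ℕ) := by
    intro v
    refine exists_injOn_of_forall_exists_encard_lt G _ _ _ fun D' hD' hne => ?_
    refine (hclosed_lt v).exists_encard_lt hk hG hne ?_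
    rw [Set.disjoint_left]
    intro x hx
    have := hD' hx
    rw [Set.Finite.mem_toFinset] at this
    exact this.2
  choose p hp_inj hp using hpos
  have hlev : ∀ x, ∃ v, x ∈ S v ∧ ∀ u < v, x ∉ S u := by
    intro x
    have hne : {v | x ∈ S v}.Nonempty := ⟨x, by
      rw [Set.mem_ofPred_eq, hS x]; exact hE_mem _ _⟩
    refine ⟨wellFounded_lt.min _ hne, wellFounded_lt.min_mem _ hne, fun u hu hxu => ?_⟩
    exact wellFounded_lt.not_lt_min {v | x ∈ S v} hxu hu
  choose l hl_mem hl_min using hlev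
  have hl_layer : ∀ x, x ∈ (hfin (l x)).toFinset := by
    intro x
    rw [Set.Finite.mem_toFinset]
    refine ⟨hl_mem x, ?_⟩
    simp only [Set.mem_iUnion, not_exists]
    exact fun u => hl_min x u u.2
  let ρ : V → V ×ₗ ℕ := fun x => toLex (l x, p (l x) x)
  have hρ : Function.Injective ρ := by
    intro x y hxy
    have h1 : l x = l y := congrArg (fun z => (ofLex z).1) hxy
    have h2 : p (l x) x = p (l y) y := congrArg (fun z => (ofLex z).2) hxy
    rw [h1] at h2
    exact hp_inj (l y) (h1 ▸ hl_layer x) (hl_layer y) h2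
  refine ⟨Order.Preimage ρ (· < ·), (RelEmbedding.preimage ⟨ρ, hρ⟩ (· < ·)).isWellOrder, fun v => ?_⟩
  refine lt_of_le_of_lt (Set.encard_le_encard ?_) (hp (l v) v (hl_layer v))
  rintro u ⟨hu, huv⟩
  refine ⟨?_, huv⟩
  have hu : ρ u < ρ v := hu
  rw [Prod.Lex.toLex_lt_toLex] at hu
  rcases hu with hu | ⟨h1, h2⟩
  · exact Or.inl (Set.mem_iUnion.2 ⟨⟨l u, hu⟩, hl_mem u⟩)
  · have h1 : l u = l v := h1
    have h2 : p (l u) u < p (l v) v := h2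
    refine Or.inr ⟨h1 ▸ hl_layer u, ?_⟩
    rwa [h1] at h2

/-! ### Colouring the edges along a well-order -/

lemma exists_coloring_of_card_le {V : Type u} [LinearOrder V] [WellFoundedLT V] {m : ℕ}
    (N : Finset V) (hN : N.card ≤ m) (D : Fin m → Set V)
    (hD : Pairwise fun i j => Disjoint (D i) (D j)) (hDN : ∀ i, D i ⊆ N)
    (s : Fin m → Setoid V) [Nonempty (Fin m)] :
    ∃ g : V → Fin m,
      (∀ u ∈ N, ∀ u' ∈ N, u ≠ u' → g u = g u' → ¬ (s (g u)) u u') ∧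
      ∀ i, ∀ u ∈ D i, ∃ u' ∈ N, g u' = i ∧ (s i) u u' := by
  classical
  let K : Fin m → Finset V := fun i =>
    N.filter fun u => u ∈ D i ∧ ∀ u' ∈ D i, (s i) u u' → u ≤ u'
  have hK : ∀ i u, u ∈ D i → ∃ u' ∈ K i, (s i) u u' := by
    intro i u hu
    have hne : {u' | u' ∈ D i ∧ (s i) u u'}.Nonempty := ⟨u, hu, (s i).refl u⟩
    obtain ⟨hm1, hm2⟩ := wellFounded_lt.min_mem _ hne
    refine ⟨wellFounded_lt.min _ hne, Finset.mem_filter.2 ⟨hDN i hm1, hm1, fun w hw hmw => ?_⟩,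
      hm2⟩
    exact not_lt.1 (wellFounded_lt.not_lt_min {u' | u' ∈ D i ∧ (s i) u u'}
      ⟨hw, (s i).trans hm2 hmw⟩)
  have hKdisj : ∀ i j u, u ∈ K i → u ∈ K j → i = j := by
    intro i j u hi hj
    by_contra hij
    exact Set.disjoint_left.1 (hD hij) (Finset.mem_filter.1 hi).2.1 (Finset.mem_filter.1 hj).2.1
  let U : Finset V := Finset.univ.biUnion K
  let I : Finset (Fin m) := Finset.univ.filter fun i => (K i).Nonempty
  have hUN : U ⊆ N := Finset.biUnion_subset.2 fun i _ => Finset.filter_subset _ _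
  have hIU : I.card ≤ U.card := by
    rw [Finset.card_biUnion fun i _ j _ hij =>
      Finset.disjoint_left.2 fun u hi hj => hij (hKdisj i j u hi hj), Finset.card_filter]
    refine Finset.sum_le_sum fun i _ => ?_
    split_ifs with h
    · exact h.card_pos
    · exact Nat.zero_le _
  have hcard : (N \ U).card ≤ (Iᶜ).card := by
    rw [Finset.card_sdiff_of_subset hUN, Finset.card_compl, Fintype.card_fin]
    omega
  obtain ⟨f, hf_maps, hf_inj⟩ := (N \ U).finite_toSet.exists_injOn_of_encard_le
    (t := ((Iᶜ : Finset (Fin m)) : Set (Fin m))) (by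
      rw [Set.encard_coe_eq_coe_finsetCard, Set.encard_coe_eq_coe_finsetCard]
      exact_mod_cast hcard)
  have hfI : ∀ u ∈ N, u ∉ U → K (f u) = ∅ := by
    intro u hu huU
    have : f u ∈ ((Iᶜ : Finset (Fin m)) : Set (Fin m)) :=
      hf_maps (by simpa using ⟨hu, huU⟩)
    simpa [I] using this
  let g : V → Fin m := fun u => if h : ∃ i, u ∈ K i then h.choose else f u
  have hgK : ∀ i u, u ∈ K i → g u = i := by
    intro i u hu
    have h : ∃ i, u ∈ K i := ⟨i, hu⟩
    simp only [g, dif_pos h]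
    exact hKdisj _ _ u h.choose_spec hu
  have hcases : ∀ u ∈ N, u ∈ K (g u) ∨ u ∉ U ∧ g u = f u := by
    intro u _
    by_cases h : ∃ i, u ∈ K i
    · obtain ⟨i, hi⟩ := h
      rw [hgK i u hi]
      exact Or.inl hi
    · refine Or.inr ⟨fun hU => h ?_, dif_neg h⟩
      obtain ⟨i, -, hi⟩ := Finset.mem_biUnion.1 hU
      exact ⟨i, hi⟩
  refine ⟨g, ?_, ?_⟩
  · intro u hu u' hu' hne hg hs
    rcases hcases u hu with h | ⟨h, hf⟩ <;> rcases hcases u' hu' with h' | ⟨h', hf'⟩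
    · rw [← hg] at h'
      obtain ⟨-, h1, h2⟩ := Finset.mem_filter.1 h
      obtain ⟨-, h3, h4⟩ := Finset.mem_filter.1 h'
      exact hne (le_antisymm (h2 _ h3 hs) (h4 _ h1 ((s _).symm hs)))
    · rw [hg, hf', hfI u' hu' h'] at h
      simp at h
    · rw [← hg, hf, hfI u hu h] at h'
      simp at h'
    · exact hne (hf_inj (by simpa using ⟨hu, h⟩) (by simpa using ⟨hu', h'⟩)
        (hf ▸ hf' ▸ hg))
  · intro i u hu
    obtain ⟨u', hu', hs⟩ := hK i u hu
    exact ⟨u', (Finset.mem_filter.1 hu').1, hgK i u' hu', hs⟩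

/-- The edges of `H` whose two ends are smaller than `v`. -/
def belowGraph {V : Type u} [LinearOrder V] (H : SimpleGraph V) (v : V) : SimpleGraph V where
  Adj x y := H.Adj x y ∧ x < v ∧ y < v
  symm := ⟨fun _ _ h => ⟨h.1.symm, h.2.2, h.2.1⟩⟩
  loopless := ⟨fun _ h => h.1.ne rfl⟩

lemma belowGraph_le {V : Type u} [LinearOrder V] (H : SimpleGraph V) (v : V) :
    belowGraph H v ≤ H :=
  fun _ _ h => h.1

/-- The edges of `G` that get colour `i`, where `c v u` is the colour of the edge between `v` and
a smaller vertex `u`. -/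
def colorGraph {V C : Type*} [LinearOrder V] (G : SimpleGraph V) (c : V → V → C) (i : C) :
    SimpleGraph V where
  Adj x y := G.Adj x y ∧ c (max x y) (min x y) = i
  symm := ⟨fun x y h => ⟨h.1.symm, by rw [max_comm, min_comm]; exact h.2⟩⟩
  loopless := ⟨fun _ h => h.1.ne rfl⟩

lemma colorGraph_adj_of_lt {V C : Type*} [LinearOrder V] {G : SimpleGraph V} {c : V → V → C}
    {i : C} {u v : V} (h : u < v) : (colorGraph G c i).Adj u v ↔ G.Adj u v ∧ c v u = i := by
  simp [colorGraph, max_eq_right h.le, min_eq_left h.le]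

lemma belowGraph_colorGraph_congr {V : Type u} {C : Type*} [LinearOrder V] (G : SimpleGraph V)
    {c c' : V → V → C} (i : C) {v : V} (h : ∀ u < v, c u = c' u) :
    belowGraph (colorGraph G c i) v = belowGraph (colorGraph G c' i) v := by
  ext x y
  simp only [belowGraph, colorGraph]
  constructor <;> rintro ⟨⟨h1, h2⟩, h3, h4⟩
  · exact ⟨⟨h1, by rw [← h _ (max_lt h3 h4)]; exact h2⟩, h3, h4⟩
  · exact ⟨⟨h1, by rw [h _ (max_lt h3 h4)]; exact h2⟩, h3, h4⟩

lemma SimpleGraph.isAcyclic_of_forall_not_reachable_belowGraph {V : Type u} [LinearOrder V]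
    {H : SimpleGraph V} (h : ∀ v, ∀ u < v, ∀ u' < v, H.Adj u v → H.Adj u' v → u ≠ u' →
      ¬ (belowGraph H v).Reachable u u') : H.IsAcyclic := by
  classical
  intro a c hc
  obtain ⟨v, hv, hmax⟩ := c.support.toFinset.exists_max_image id
    ⟨a, by simp⟩
  simp only [List.mem_toFinset, id] at hv hmax
  have hc' := hc.rotate hv
  have hmax' : ∀ w ∈ (c.rotate v hv).support, w ≤ v := fun w hw =>
    hmax w ((SimpleGraph.Walk.mem_support_rotate_iff ..).1 hw)
  generalize c.rotate v hv = d at hc' hmax'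
  cases d with
  | nil => exact hc'.ne_nil rfl
  | @cons _ u _ hvu q =>
    rw [SimpleGraph.Walk.cons_isCycle_iff] at hc'
    have hq : ¬ q.Nil := fun hn => hvu.ne hn.eq.symm
    have hsup := SimpleGraph.Walk.support_dropLast_concat hq
    have hnd := hc'.1.support_nodup
    rw [← hsup, List.nodup_append] at hnd
    have hlt : ∀ w ∈ q.dropLast.support, w < v := by
      intro w hw
      refine lt_of_le_of_ne (hmax' w ?_) (hnd.2.2 w hw v (by simp))
      rw [SimpleGraph.Walk.support_cons, ← hsup]
      simp [hw]
    have hadj := SimpleGraph.Walk.adj_penultimate hq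
    refine h v u (hlt u (SimpleGraph.Walk.start_mem_support _)) q.penultimate
      (hlt _ (SimpleGraph.Walk.end_mem_support _)) hvu.symm hadj ?_ ?_
    · intro hu
      refine hc'.2 ?_
      have : s(q.penultimate, v) ∈ q.edges := q.mk_penultimate_end_mem_edges hq
      rwa [← hu, Sym2.eq_swap] at this
    · refine ⟨q.dropLast.transfer _ fun e he => ?_⟩
      induction e using Sym2.ind with
      | _ x y =>
        exact ⟨q.dropLast.adj_of_mem_edges he, hlt x (q.dropLast.fst_mem_support_of_mem_edges he),
          hlt y (q.dropLast.snd_mem_support_of_mem_edges he)⟩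

lemma SimpleGraph.Connected.of_forall_exists_reachable_belowGraph {V : Type u} [LinearOrder V]
    {B H : SimpleGraph V} (hB : B.Connected) (h : ∀ v, ∀ u < v, B.Adj u v →
      ∃ u', H.Adj u' v ∧ (belowGraph H v).Reachable u u') : H.Connected := by
  have hlt : ∀ u v, u < v → B.Adj u v → H.Reachable u v := by
    intro u v huv hadj
    obtain ⟨u', h1, h2⟩ := h v u huv hadj
    exact (h2.mono (belowGraph_le H v)).trans h1.reachable
  have hadj : ∀ u v, B.Adj u v → H.Reachable u v := by
    intro u v hadj
    rcases lt_or_gt_of_ne hadj.ne with huv | huv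
    · exact hlt u v huv hadj
    · exact (hlt v u huv hadj.symm).symm
  have := hB.nonempty
  refine ⟨fun u v => ?_⟩
  obtain ⟨p⟩ := hB.preconnected u v
  induction p with
  | nil => rfl
  | cons hxy _ ih => exact (hadj _ _ hxy).trans ih

lemma hasDecompositionN_of_hasPackingN_of_encard_le {V : Type u} [LinearOrder V]
    [WellFoundedLT V] {G : SimpleGraph V} {m : ℕ} [Nonempty (Fin m)] (hG : HasPackingN G m)
    (hdeg : ∀ v, {u | u < v ∧ G.Adj v u}.encard ≤ m) : HasDecompositionN G m := by
  classical
  obtain ⟨B, hB, hBdisj⟩ := hG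
  have hstep : ∀ (v : V) (c : V → V → Fin m), ∃ g : V → Fin m,
      (∀ u < v, ∀ u' < v, G.Adj u v → G.Adj u' v → u ≠ u' → g u = g u' →
        ¬ (belowGraph (colorGraph G c (g u)) v).Reachable u u') ∧
      ∀ i, ∀ u < v, (B i).Adj u v → ∃ u' < v, G.Adj u' v ∧ g u' = i ∧
        (belowGraph (colorGraph G c i) v).Reachable u u' := by
    intro v c
    have hfin : {u | u < v ∧ G.Adj v u}.Finite := Set.finite_of_encard_le_coe (hdeg v)
    obtain ⟨g, hg1, hg2⟩ := exists_coloring_of_card_le hfin.toFinset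
      (by have := hdeg v; rw [hfin.encard_eq_coe_toFinset_card] at this; exact_mod_cast this)
      (fun i => {u | u < v ∧ (B i).Adj v u})
      (fun i j hij => Set.disjoint_left.2 fun u hi hj =>
        Set.disjoint_left.1 (hBdisj hij) (show s(v, u) ∈ (B i).edgeSet from hi.2) hj.2)
      (fun i u hu => by simpa using ⟨hu.1, (hB i).1 hu.2⟩)
      (fun i => (belowGraph (colorGraph G c i) v).reachableSetoid)
    refine ⟨g, fun u hu u' hu' ha ha' => hg1 u (by simpa using ⟨hu, ha.symm⟩) u'
      (by simpa using ⟨hu', ha'.symm⟩), fun i u hu ha => ?_⟩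
    obtain ⟨u', h1, h2, h3⟩ := hg2 i u ⟨hu, ha.symm⟩
    rw [Set.Finite.mem_toFinset] at h1
    exact ⟨u', h1.1, h1.2.symm, h2, h3⟩
  choose g hg_forest hg_conn using hstep
  let c : V → V → Fin m := WellFoundedLT.fix fun v ih =>
    g v fun u => if h : u < v then ih u h else fun _ => Classical.arbitrary _
  have hc : ∀ v, c v = g v fun u => if u < v then c u else fun _ => Classical.arbitrary _ := by
    intro v
    refine (WellFoundedLT.fix_eq _ v).trans ?_
    congr 1
  have hbelow : ∀ v i, belowGraph (colorGraph G (fun u => if u < v then c u else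
      fun _ => Classical.arbitrary _) i) v = belowGraph (colorGraph G c i) v :=
    fun v i => belowGraph_colorGraph_congr G i fun u hu => if_pos hu
  refine ⟨colorGraph G c, fun i => ⟨fun _ _ h => h.1, ?_, ?_⟩, ?_, ?_⟩
  · refine (hB i).2.1.of_forall_exists_reachable_belowGraph fun v u huv hadj => ?_
    obtain ⟨u', h1, h2, h3, h4⟩ := hg_conn v _ i u huv hadj
    rw [← hc v] at h3
    rw [hbelow] at h4
    exact ⟨u', (colorGraph_adj_of_lt h1).2 ⟨h2, h3⟩, h4⟩
  · refine SimpleGraph.isAcyclic_of_forall_not_reachable_belowGraph ?_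
    intro v u hu u' hu' ha ha' hne hr
    rw [colorGraph_adj_of_lt hu] at ha
    rw [colorGraph_adj_of_lt hu'] at ha'
    refine hg_forest v (fun u => if u < v then c u else fun _ => Classical.arbitrary _)
      u hu u' hu' ha.1 ha'.1 hne ?_ ?_
    · rw [← hc v, ha.2, ha'.2]
    · rw [← hc v, hbelow, ha.2]
      exact hr
  · intro i j hij
    refine Set.disjoint_left.2 fun e hi hj => ?_
    induction e using Sym2.ind with
    | _ x y => exact hij (hi.2.symm.trans hj.2)
  · ext e
    induction e using Sym2.ind with
    | _ x y =>
      simp only [Set.mem_iUnion, SimpleGraph.mem_edgeSet]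
      exact ⟨fun ⟨i, h⟩ => h.1, fun h => ⟨_, h, rfl⟩⟩

/-- For every k ≥ 1, every graph with a k-covering and a (2k−1)-packing has a
(2k−1)-decomposition. -/
theorem decompositionN_of_coveringN_packingN {V : Type u} (G : SimpleGraph V)
    (k : ℕ) (hk : 1 ≤ k) (hcov : HasCoveringN G k)
    (hpack : HasPackingN G (2 * k - 1)) :
    HasDecompositionN G (2 * k - 1) := by
  obtain ⟨r, hr, hdeg⟩ := hcov.exists_isWellOrder hk
  classical
  let _ : LinearOrder V := linearOrderOfSTO r
  have : WellFoundedLT V := ⟨hr.wf⟩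
  have : Nonempty (Fin (2 * k - 1)) := ⟨⟨0, by omega⟩⟩
  refine hasDecompositionN_of_hasPackingN_of_encard_le hpack fun v => ?_
  have h : {u | u < v ∧ G.Adj v u}.encard < ((2 * k - 1 : ℕ) + 1 : ℕ∞) := by
    have := hdeg v
    rw [← Nat.sub_add_cancel (show 1 ≤ 2 * k by omega)] at this
    exact_mod_cast this
  exact ENat.lt_add_one_iff (ENat.natCast_ne_top _) |>.1 h
end

section
/- For every natural number k ≥ 1, a graph G (finite or infinite) admits a k-covering if and only if G is connected and for every nonempty finite set U of vertices of G, the number of edges of G with both endpoints in U is at most k·(|U| − 1). -/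
universe u
open Cardinal

namespace SimpleGraph

variable {V : Type u} {κ : Type*}

/-- The graph formed by the edges in `S` to which the colouring `c` assigns the colour `i`. -/
def colorClass (S : Set (Sym2 V)) (c : Sym2 V → κ) (i : κ) : SimpleGraph V :=
  fromEdgeSet {f | f ∈ S ∧ c f = i}

lemma colorClass_adj {S : Set (Sym2 V)} {c : Sym2 V → κ} {i : κ} {u v : V} :
    (colorClass S c i).Adj u v ↔ (s(u, v) ∈ S ∧ c s(u, v) = i) ∧ u ≠ v :=
  fromEdgeSet_adj _

lemma mem_edgeSet_colorClass {S : Set (Sym2 V)} {c : Sym2 V → κ} {i : κ} {f : Sym2 V} :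
    f ∈ (colorClass S c i).edgeSet ↔ (f ∈ S ∧ c f = i) ∧ ¬ f.IsDiag := by
  induction f with | _ u v => simp [colorClass_adj]

lemma colorClass_mono {S S' : Set (Sym2 V)} (h : S ⊆ S') (c : Sym2 V → κ) (i : κ) :
    colorClass S c i ≤ colorClass S' c i :=
  fromEdgeSet_mono fun _ hf ↦ ⟨h hf.1, hf.2⟩

lemma reachable_of_adj_imp_reachable {G H : SimpleGraph V}
    (h : ∀ u v, G.Adj u v → H.Reachable u v) {u v : V} (huv : G.Reachable u v) :
    H.Reachable u v := by
  obtain ⟨p⟩ := huv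
  induction p with
  | nil => rfl
  | cons hadj _ ih => exact (h _ _ hadj).trans ih

open Classical in
/-- Giving an edge a colour in whose class its ends are not connected closes no cycle. -/
lemma isAcyclic_colorClass_update {S : Set (Sym2 V)} {c : Sym2 V → κ} {i : κ} {x y : V}
    (hS : ∀ j, (colorClass (S \ {s(x, y)}) c j).IsAcyclic)
    (hxy : ¬ (colorClass (S \ {s(x, y)}) c i).Reachable x y) (j : κ) :
    (colorClass S (Function.update c s(x, y) i) j).IsAcyclic := by
  by_cases hji : j = i
  · subst hji
    refine ((hS j).sup_edge_of_not_reachable hxy).anti fun u v huv ↦ ?_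
    obtain ⟨⟨hf, hc⟩, hne⟩ := colorClass_adj.1 huv
    by_cases hfe : s(u, v) = s(x, y)
    · exact Or.inr ((edge_adj _ _ _ _).2 ⟨by simpa using hfe, hne⟩)
    · rw [Function.update_of_ne hfe] at hc
      exact Or.inl (colorClass_adj.2 ⟨⟨⟨hf, hfe⟩, hc⟩, hne⟩)
  · refine (hS j).anti fun u v huv ↦ ?_
    obtain ⟨⟨hf, hc⟩, hne⟩ := colorClass_adj.1 huv
    by_cases hfe : s(u, v) = s(x, y)
    · rw [hfe, Function.update_self] at hc
      exact absurd hc.symm hji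
    · rw [Function.update_of_ne hfe] at hc
      exact colorClass_adj.2 ⟨⟨⟨hf, hfe⟩, hc⟩, hne⟩

/-- A colour assignment `s.1` with acyclic colour classes on all of `E` except for the
one edge `s.2`. -/
def IsForestColoringExcept (E : Set (Sym2 V)) (s : (Sym2 V → κ) × Sym2 V) : Prop :=
  s.2 ∈ E ∧ ∀ i, (colorClass (E \ {s.2}) s.1 i).IsAcyclic

open Classical in
/-- `t` arises from `s` by giving the uncoloured edge of `s` the colour of another edge,
which becomes the uncoloured edge of `t`. -/
def Exchange (E : Set (Sym2 V)) (s t : (Sym2 V → κ) × Sym2 V) : Prop :=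
  IsForestColoringExcept E t ∧ t.1 = Function.update s.1 s.2 (s.1 t.2)

/-- The edges left uncoloured by some colouring obtained from `s` by exchanges. -/
def exchangeSet (E : Set (Sym2 V)) (s : (Sym2 V → κ) × Sym2 V) : Set (Sym2 V) :=
  {f | ∃ t, Relation.ReflTransGen (Exchange E) s t ∧ t.2 = f}

lemma IsForestColoringExcept.of_reflTransGen {E : Set (Sym2 V)} {s t : (Sym2 V → κ) × Sym2 V}
    (hs : IsForestColoringExcept E s) (h : Relation.ReflTransGen (Exchange E) s t) :
    IsForestColoringExcept E t := by
  cases h with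
  | refl => exact hs
  | tail _ h => exact h.1

/-- If `E` has no colouring with acyclic classes, the ends of the uncoloured edge are joined in
every colour by a path each of whose edges can be exchanged for it. -/
lemma IsForestColoringExcept.exists_walk {E : Set (Sym2 V)} {c : Sym2 V → κ} {x y : V}
    (hs : IsForestColoringExcept E (c, s(x, y)))
    (hE : ¬ ∃ c : Sym2 V → κ, ∀ i, (colorClass E c i).IsAcyclic) (i : κ) :
    ∃ p : (colorClass (E \ {s(x, y)}) c i).Walk x y, ∀ g ∈ p.edges,
      ∃ t, Exchange E (c, s(x, y)) t ∧ t.2 = g := by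
  classical
  have hr : (colorClass (E \ {s(x, y)}) c i).Reachable x y := by
    by_contra hr
    exact hE ⟨_, isAcyclic_colorClass_update hs.2 hr⟩
  obtain ⟨p, hp⟩ := hr.exists_isPath
  refine ⟨p, fun g hg ↦ ⟨(Function.update c s(x, y) i, g), ⟨⟨?_, ?_⟩, ?_⟩, rfl⟩⟩
  · exact (mem_edgeSet_colorClass.1 (p.edges_subset_edgeSet hg)).1.1.1
  · have hle : (E \ {g}) \ {s(x, y)} ⊆ E \ {s(x, y)} := fun f hf ↦ ⟨hf.1.1, hf.2⟩
    refine isAcyclic_colorClass_update (fun j ↦ (hs.2 j).anti (colorClass_mono hle c j)) ?_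
    intro hr'
    obtain ⟨q, hq⟩ := hr'.exists_isPath
    have hle' := colorClass_mono hle c i
    have heq := congrArg Subtype.val <|
      ((hs.2 i).subsingleton_path x y).elim ⟨p, hp⟩ ⟨q.mapLe hle', hq.mapLe hle'⟩
    simp only at heq
    rw [heq, Walk.edges_mapLe_eq_edges] at hg
    exact (mem_edgeSet_colorClass.1 (q.edges_subset_edgeSet hg)).1.1.1.2 rfl
  · simp [(mem_edgeSet_colorClass.1 (p.edges_subset_edgeSet hg)).1.2]

lemma reachable_of_reflTransGen_exchange {E : Set (Sym2 V)} {s t : (Sym2 V → κ) × Sym2 V}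
    (hs : IsForestColoringExcept E s)
    (hE : ¬ ∃ c : Sym2 V → κ, ∀ i, (colorClass E c i).IsAcyclic)
    (h : Relation.ReflTransGen (Exchange E) s t) (i : κ) {x y : V} (hxy : t.2 = s(x, y)) :
    (colorClass (exchangeSet E s ∩ (E \ {t.2})) t.1 i).Reachable x y := by
  obtain ⟨c, e⟩ := t
  obtain rfl : e = s(x, y) := hxy
  obtain ⟨p, hp⟩ := (hs.of_reflTransGen h).exists_walk hE i
  refine (p.transfer _ fun g hg ↦ ?_).reachable
  obtain ⟨t, ht, rfl⟩ := hp g hg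
  obtain ⟨⟨h₁, h₂⟩, h₃⟩ := mem_edgeSet_colorClass.1 (p.edges_subset_edgeSet hg)
  exact mem_edgeSet_colorClass.2 ⟨⟨⟨⟨t, h.tail ht, rfl⟩, h₁⟩, h₂⟩, h₃⟩

/-- Exchanges do not enlarge the connectivity of a colour class within the exchange set. -/
lemma reachable_colorClass_of_reflTransGen {E : Set (Sym2 V)} {s t : (Sym2 V → κ) × Sym2 V}
    (hs : IsForestColoringExcept E s)
    (hE : ¬ ∃ c : Sym2 V → κ, ∀ i, (colorClass E c i).IsAcyclic)
    (h : Relation.ReflTransGen (Exchange E) s t) (i : κ) {u v : V}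
    (huv : (colorClass (exchangeSet E s ∩ (E \ {t.2})) t.1 i).Reachable u v) :
    (colorClass (exchangeSet E s ∩ (E \ {s.2})) s.1 i).Reachable u v := by
  classical
  induction h generalizing u v with
  | refl => exact huv
  | @tail a b hsa hab ih =>
    refine ih (reachable_of_adj_imp_reachable (fun u v hadj ↦ ?_) huv)
    by_cases hf : a.2 = s(u, v)
    · exact reachable_of_reflTransGen_exchange hs hE hsa i hf
    · obtain ⟨⟨⟨hR, hfE, -⟩, hc⟩, hne⟩ := colorClass_adj.1 hadj
      rw [hab.2, Function.update_of_ne (Ne.symm hf)] at hc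
      exact Adj.reachable (colorClass_adj.2 ⟨⟨⟨hR, hfE, Ne.symm hf⟩, hc⟩, hne⟩)

lemma reachable_colorClass_exchangeSet_iff {E : Set (Sym2 V)} {s : (Sym2 V → κ) × Sym2 V}
    (hs : IsForestColoringExcept E s)
    (hE : ¬ ∃ c : Sym2 V → κ, ∀ i, (colorClass E c i).IsAcyclic) (i : κ) {u v : V} :
    (colorClass (exchangeSet E s ∩ (E \ {s.2})) s.1 i).Reachable u v ↔
      (fromEdgeSet (exchangeSet E s)).Reachable u v := by
  refine ⟨.mono (fromEdgeSet_mono fun _ hf ↦ hf.1.1), fun h ↦ ?_⟩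
  refine reachable_of_adj_imp_reachable (fun u v hadj ↦ ?_) h
  obtain ⟨⟨t, ht, htf⟩, -⟩ := (fromEdgeSet_adj _).1 hadj
  exact reachable_colorClass_of_reflTransGen hs hE ht i
    (reachable_of_reflTransGen_exchange hs hE ht i htf)

lemma finite_setOf_reachable_fromEdgeSet {R : Set (Sym2 V)} (hR : R.Finite) (x : V) :
    {v | (fromEdgeSet R).Reachable v x}.Finite := by
  classical
  have : (insert x (⋃ f ∈ R, {v | v ∈ f})).Finite := by
    refine (hR.biUnion fun f _ ↦ ?_).insert x
    refine f.toFinset.finite_toSet.subset fun v hv ↦ ?_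
    simpa using hv
  refine this.subset fun v ⟨p⟩ ↦ ?_
  cases p with
  | nil => exact Set.mem_insert _ _
  | cons h _ =>
    exact Set.mem_insert_of_mem _
      (Set.mem_biUnion ((fromEdgeSet_adj _).1 h).1 (Sym2.mem_mk_left _ _))

lemma mul_lt_ncard_of_pairwise_disjoint {α ι : Type*} [Fintype ι] {n : ℕ} {A : ι → Set α}
    {B : Set α} (hB : B.Finite) (hA : ∀ i, A i ⊆ B) (hn : ∀ i, n ≤ (A i).ncard)
    (hd : Pairwise (Function.onFun Disjoint A)) {e : α} (heB : e ∈ B) (heA : ∀ i, e ∉ A i) :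
    Fintype.card ι * n < B.ncard := by
  have hfin : ∀ i, (A i).Finite := fun i ↦ hB.subset (hA i)
  calc Fintype.card ι * n ≤ ∑ i, (A i).ncard := by
        simpa using Finset.card_nsmul_le_sum Finset.univ (fun i ↦ (A i).ncard) n fun i _ ↦ hn i
    _ = (⋃ i, A i).ncard := by
        rw [Set.ncard_iUnion_of_finite hfin hd, finsum_eq_sum_of_fintype]
    _ < B.ncard := Set.ncard_lt_ncard
        ⟨Set.iUnion_subset hA, fun h ↦ by simpa [heA] using h heB⟩ hB

/-- If the uncoloured edge cannot be coloured, the component of the exchange set which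
contains it has too many edges. -/
theorem exists_forestColoring_of_except {G : SimpleGraph V} {k : ℕ}
    (hG : ∀ U : Finset V, U.Nonempty →
      Nat.card ((G.induce (↑U : Set V)).edgeSet) ≤ k * (U.card - 1))
    {E : Set (Sym2 V)} (hEfin : E.Finite) (hEG : E ⊆ G.edgeSet)
    {s : (Sym2 V → Fin k) × Sym2 V} (hs : IsForestColoringExcept E s) :
    ∃ c : Sym2 V → Fin k, ∀ i, (colorClass E c i).IsAcyclic := by
  classical
  by_contra hE
  obtain ⟨x, y, hxy⟩ : ∃ x y, s.2 = s(x, y) := Sym2.ind (fun x y ↦ ⟨x, y, rfl⟩) s.2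
  have hadj : G.Adj x y := by
    have := hEG hs.1
    rwa [hxy] at this
  set R := exchangeSet E s
  have hRE : R ⊆ E := by
    rintro _ ⟨t, ht, rfl⟩
    exact (hs.of_reflTransGen ht).1
  have hfin := finite_setOf_reachable_fromEdgeSet (hEfin.subset hRE) x
  obtain ⟨U, hU⟩ := hfin.exists_finset_coe
  have hxU : x ∈ U := by
    rw [← Finset.mem_coe, hU]
    exact Reachable.refl x
  have hyU : y ∈ U := by
    rw [← Finset.mem_coe, hU]
    exact ((fromEdgeSet_adj R).2 ⟨⟨s, .refl, hxy⟩, hadj.ne⟩).reachable.symm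
  let H (i : Fin k) := colorClass (R ∩ (E \ {s.2})) s.1 i
  have hconn (i : Fin k) : ((H i).induce (U : Set V)).Connected := by
    have : (U : Set V) = ((H i).connectedComponentMk x).supp := by
      ext v
      rw [hU, ConnectedComponent.mem_supp_iff, ConnectedComponent.eq]
      exact (reachable_colorClass_exchangeSet_iff hs hE i).symm
    rw [this]
    exact ConnectedComponent.connected_toSimpleGraph _
  refine (hG U ⟨x, hxU⟩).not_gt ?_
  have := mul_lt_ncard_of_pairwise_disjoint (n := U.card - 1)
    (A := fun i ↦ ((H i).induce (U : Set V)).edgeSet) (B := (G.induce (U : Set V)).edgeSet)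
    (Set.toFinite _) ?_ ?_ ?_ (e := s(⟨x, hxU⟩, ⟨y, hyU⟩)) ?_ ?_
  · rwa [Fintype.card_fin, ← Nat.card_coe_set_eq] at this
  · intro i
    refine edgeSet_mono (comap_monotone _ fun u v huv ↦ ?_)
    exact hEG (colorClass_adj.1 huv).1.1.2.1
  · intro i
    have := (hconn i).card_vert_le_card_edgeSet_add_one
    rw [Nat.card_coe_set_eq, Nat.card_coe_set_eq, Set.ncard_coe_finset] at this
    omega
  · intro i j hij
    refine Set.disjoint_left.2 fun f ↦ ?_
    induction f with | _ u v =>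
    intro hi hj
    exact hij ((colorClass_adj.1 hi).1.2.symm.trans (colorClass_adj.1 hj).1.2)
  · exact hadj
  · intro i hi
    exact (colorClass_adj.1 hi).1.1.2.2 hxy.symm

theorem exists_forestColoring_of_finset {G : SimpleGraph V} {k : ℕ} (hk : 1 ≤ k)
    (hG : ∀ U : Finset V, U.Nonempty →
      Nat.card ((G.induce (↑U : Set V)).edgeSet) ≤ k * (U.card - 1)) (E : Finset (Sym2 V)) :
    ∃ c : Sym2 V → Fin k, ∀ i, (colorClass (E ∩ G.edgeSet) c i).IsAcyclic := by
  classical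
  induction E using Finset.induction_on with
  | empty => exact ⟨fun _ ↦ ⟨0, hk⟩, fun i ↦ by simp [colorClass]⟩
  | insert e E he ih =>
    by_cases heG : e ∈ G.edgeSet
    · obtain ⟨c, hc⟩ := ih
      refine exists_forestColoring_of_except hG ((Finset.finite_toSet _).inter_of_left _)
        Set.inter_subset_right (s := (c, e)) ⟨by simp [heG], fun i ↦ (hc i).anti ?_⟩
      refine colorClass_mono ?_ c i
      rintro f ⟨⟨hf, hfG⟩, hfe⟩
      exact ⟨Finset.mem_of_mem_insert_of_ne hf hfe, hfG⟩
    · rwa [Finset.coe_insert, Set.insert_inter_of_notMem heG]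

theorem exists_forestColoring {G : SimpleGraph V} {k : ℕ} (hk : 1 ≤ k)
    (hG : ∀ U : Finset V, U.Nonempty →
      Nat.card ((G.induce (↑U : Set V)).edgeSet) ≤ k * (U.card - 1)) :
    ∃ c : Sym2 V → Fin k, ∀ i, (colorClass G.edgeSet c i).IsAcyclic := by
  classical
  choose g hg using exists_forestColoring_of_finset hk hG
  obtain ⟨χ, hχ⟩ := Finset.rado_selection g
  refine ⟨χ, fun i v p hp ↦ ?_⟩
  obtain ⟨t, hst, ht⟩ := hχ p.edges.toFinset
  refine hg t i _ (hp.transfer fun f hf ↦ ?_)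
  obtain ⟨⟨h₁, h₂⟩, h₃⟩ := mem_edgeSet_colorClass.1 (p.edges_subset_edgeSet hf)
  have hf' := List.mem_toFinset.2 hf
  exact mem_edgeSet_colorClass.2 ⟨⟨⟨hst hf', h₁⟩, ht f hf' ▸ h₂⟩, h₃⟩

lemma IsAcyclic.card_edgeSet_le [Finite V] {G : SimpleGraph V} (h : G.IsAcyclic) :
    Nat.card G.edgeSet ≤ Nat.card V - 1 := by
  cases isEmpty_or_nonempty V
  · simp [Subsingleton.elim G ⊥]
  · obtain ⟨F, hGF, -, hF⟩ := connected_top.exists_isTree_le_of_le_of_isAcyclic le_top h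
    have hcard := (isTree_iff_connected_and_card.1 hF).2
    have := Nat.card_mono (Set.toFinite F.edgeSet) (edgeSet_mono hGF)
    omega

end SimpleGraph

/-- Nash-Williams: for k ≥ 1, a graph admits a k-covering iff it is connected and,
for every nonempty finite set U of vertices, the number of edges with both endpoints
in U is at most k · (|U| − 1). -/
theorem coveringN_iff_nashWilliams {V : Type u} (G : SimpleGraph V) (k : ℕ)
    (hk : 1 ≤ k) :
    HasCoveringN G k ↔ G.Connected ∧ ∀ U : Finset V, U.Nonempty →
      Nat.card ((G.induce (↑U : Set V)).edgeSet) ≤ k * (U.card - 1) := by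
  constructor
  · rintro ⟨T, hT, hcov⟩
    refine ⟨(hT ⟨0, hk⟩).2.connected.mono (hT ⟨0, hk⟩).1, fun U _ ↦ ?_⟩
    have hsub : (G.induce (U : Set V)).edgeSet ⊆
        ⋃ i, ((T i).induce (U : Set V)).edgeSet := by
      intro f hf
      induction f with | _ u v =>
      have : s((u : V), (v : V)) ∈ ⋃ i, (T i).edgeSet := hcov ▸ hf
      simpa using this
    calc Nat.card (G.induce (U : Set V)).edgeSet
        ≤ (⋃ i, ((T i).induce (U : Set V)).edgeSet).ncard :=
          Set.ncard_le_ncard hsub (Set.toFinite _)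
      _ ≤ ∑ i, ((T i).induce (U : Set V)).edgeSet.ncard := by
          simpa using Set.ncard_iUnion_le_of_fintype _
      _ ≤ ∑ _i : Fin k, (U.card - 1) := Finset.sum_le_sum fun i _ ↦ by
          simpa using ((hT i).2.isAcyclic.induce (U : Set V)).card_edgeSet_le
      _ = k * (U.card - 1) := by simp
  · rintro ⟨hconn, hG⟩
    obtain ⟨c, hc⟩ := SimpleGraph.exists_forestColoring hk hG
    have hle (i : Fin k) : SimpleGraph.colorClass G.edgeSet c i ≤ G :=
      fun _ _ h ↦ (SimpleGraph.colorClass_adj.1 h).1.1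
    choose T hFT hTG hT using fun i ↦ hconn.exists_isTree_le_of_le_of_isAcyclic (hle i) (hc i)
    refine ⟨T, fun i ↦ ⟨hTG i, hT i⟩, Set.Subset.antisymm
      (Set.iUnion_subset fun i ↦ SimpleGraph.edgeSet_mono (hTG i)) fun f hf ↦ ?_⟩
    exact Set.mem_iUnion.2 ⟨c f, SimpleGraph.edgeSet_mono (hFT (c f))
      (SimpleGraph.mem_edgeSet_colorClass.2 ⟨⟨hf, rfl⟩, G.not_isDiag_of_mem_edgeSet hf⟩)⟩
end

section
/- Let k be a positive natural number and let G be a finite graph. If G admits both a k-packing and a k-covering, then G admits a k-decomposition. -/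
universe u
open Cardinal

/-- A spanning tree of a graph on a finite vertex set has one edge fewer than vertices. -/
theorem IsSpanningTree.card_edgeFinset_add_one {V : Type u} [Fintype V] {G T : SimpleGraph V}
    [Fintype T.edgeSet] (h : IsSpanningTree G T) :
    T.edgeFinset.card + 1 = Fintype.card V :=
  h.2.card_edgeFinset

/-- For a positive natural number k, a finite graph admitting both a k-packing and a
k-covering admits a k-decomposition. -/
theorem finite_decompositionN_of_packingN_coveringN {V : Type u} [Fintype V]
    (G : SimpleGraph V) (k : ℕ) (hk : 0 < k)
    (hpack : HasPackingN G k) (hcov : HasCoveringN G k) :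
    HasDecompositionN G k := by
  classical
  obtain ⟨P, hP, hdisj⟩ := hpack
  obtain ⟨C, hC, hCG⟩ := hcov
  refine ⟨P, hP, hdisj, ?_⟩
  have hcardP (i) : (P i).edgeFinset.card = Fintype.card V - 1 :=
    Nat.eq_sub_of_add_eq (hP i).card_edgeFinset_add_one
  have hcardC (i) : (C i).edgeFinset.card = Fintype.card V - 1 :=
    Nat.eq_sub_of_add_eq (hC i).card_edgeFinset_add_one
  have hsub : Finset.univ.biUnion (fun i => (P i).edgeFinset) ⊆ G.edgeFinset :=
    Finset.biUnion_subset.2 fun i _ => SimpleGraph.edgeFinset_mono (hP i).1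
  have hGC : G.edgeFinset = Finset.univ.biUnion (fun i => (C i).edgeFinset) := by
    rw [← Finset.coe_inj]
    simp [hCG]
  have hcard : G.edgeFinset.card ≤
      (Finset.univ.biUnion (fun i => (P i).edgeFinset)).card := by
    rw [Finset.card_biUnion fun i _ j _ hij =>
      SimpleGraph.disjoint_edgeFinset.2 (SimpleGraph.disjoint_edgeSet.1 (hdisj hij)), hGC]
    refine Finset.card_biUnion_le.trans_eq ?_
    simp only [hcardP, hcardC]
  have heq := Finset.eq_of_subset_of_card_le hsub hcard
  rw [← Finset.coe_inj] at heq
  simpa using heq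
end
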